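/- Approximation of a flow by a separable shallow-network Hamiltonian flow: Let Ω ⊂ ℝ^{2d} be compact and let σ : ℝ → ℝ be continuously differentiable and not a polynomial. Let H̃ : ℝ × ℝ^{2d} → ℝ be a polynomial in the phase-space variable x with coefficients depending continuously on t, and let Φ : Ω → ℝ^{2d} be the flow map of the H̃-system over a subinterval [a,b] ⊆ [0,Δt] (i.e. Φ(x₀) = z(b) where z solves z'(s) = J∇_x H̃(s,z(s)), z(a) = x₀), taking values in a compact set. Then for every ε > 0 there exist functions V̄_q, V̄_p in the shallow-network class F such that the separable Hamiltonian H̄(s,(q,p)) = V̄_p(s,p) + V̄_q(s,q) has a time-1 flow φ_{H̄,1} (from time 0) satisfying sup over x ∈ Ω of ‖φ_{H̄,1}(x) − Φ(x)‖_∞ < ε. -/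

import Mathlib

noncomputable section

/-- Phase-space factor `ℝ^d`. -/
abbrev Vec (d : ℕ) := EuclideanSpace ℝ (Fin d)

/-- Phase space `ℝ^{2d}` split as positions and momenta. -/
abbrev Phase (d : ℕ) := Vec d × Vec d

/-- Gradient with respect to the position variable. -/
def gradQ {d : ℕ} (H : Phase d → ℝ) (x : Phase d) : Vec d :=
  gradient (fun q => H (q, x.2)) x.1

/-- Gradient with respect to the momentum variable. -/
def gradP {d : ℕ} (H : Phase d → ℝ) (x : Phase d) : Vec d :=
  gradient (fun p => H (x.1, p)) x.2

/-- `J ∇H (q,p) = (∇ₚH(q,p), −∇_qH(q,p))`. -/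
def JgradH {d : ℕ} (H : Phase d → ℝ) (x : Phase d) : Phase d :=
  (gradP H x, - gradQ H x)

/-- Supremum norm on `ℝ^{2d}`: the max of the absolute values of all `2d` coordinates. -/
def supNorm {d : ℕ} (x : Phase d) : ℝ :=
  max ‖(WithLp.equiv 2 (Fin d → ℝ)) x.1‖ ‖(WithLp.equiv 2 (Fin d → ℝ)) x.2‖

/-- The shallow-network class `F = { (s,y) ↦ wᵀ σ (A y + b s + c) }`. -/
def ShallowClass {d : ℕ} (σ : ℝ → ℝ) (V : ℝ → Vec d → ℝ) : Prop :=
  ∃ (h : ℕ) (A : Matrix (Fin h) (Fin d) ℝ) (b c w : Fin h → ℝ),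
    ∀ (s : ℝ) (y : Vec d),
      V s y = ∑ i, w i * σ ((∑ j, A i j * y j) + b i * s + c i)

/-- `G : ℝ × ℝ^{2d} → ℝ` is a polynomial in the phase-space variable with coefficients
depending continuously on time. -/
def IsPolyContCoeff {d : ℕ} (G : ℝ → Phase d → ℝ) : Prop :=
  ∃ (n : ℕ) (c : Fin n → ℝ → ℝ) (P : Fin n → MvPolynomial (Fin d ⊕ Fin d) ℝ),
    (∀ i, Continuous (c i)) ∧
    ∀ (t : ℝ) (x : Phase d),
      G t x = ∑ i, c i t *
        MvPolynomial.eval (Sum.elim (fun j => x.1 j) (fun j => x.2 j)) (P i)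

section Development

open Set Filter Topology MeasureTheory
open scoped ContDiff

section

/-- If all values of a polynomial curve with vector coefficients lie in a submodule, so do its
coefficients. -/
theorem coeff_mem_of_forall_sum_pow_smul_mem {E : Type*} [AddCommGroup E] [Module ℝ E]
    (M : Submodule ℝ E) {N : ℕ} (m : Fin N → E)
    (h : ∀ r : ℝ, ∑ i : Fin N, r ^ (i : ℕ) • m i ∈ M) (i : Fin N) : m i ∈ M := by
  classical
  set V : Matrix (Fin N) (Fin N) ℝ := Matrix.vandermonde (fun j : Fin N => ((j : ℕ) : ℝ)) with hV
  have hdet : IsUnit V.det := by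
    rw [isUnit_iff_ne_zero, hV, Matrix.det_vandermonde_ne_zero_iff]
    intro a b hab
    have hab' : ((a : ℕ) : ℝ) = ((b : ℕ) : ℝ) := hab
    exact Fin.ext (by exact_mod_cast hab')
  have key : m i = ∑ j, V⁻¹ i j • ∑ k, V j k • m k := by
    simp_rw [Finset.smul_sum, smul_smul]
    rw [Finset.sum_comm]
    simp_rw [← Finset.sum_smul, ← Matrix.mul_apply, Matrix.nonsing_inv_mul V hdet,
      Matrix.one_apply, ite_smul, one_smul, zero_smul]
    simp
  rw [key]
  refine M.sum_mem fun j _ => M.smul_mem _ ?_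
  simpa [hV, Matrix.vandermonde_apply] using h ((j : ℕ) : ℝ)

/-- The span of all powers of elements of `W`. -/
def powSpan {A : Type*} [CommRing A] [Algebra ℝ A] (W : Submodule ℝ A) : Submodule ℝ A :=
  Submodule.span ℝ {x | ∃ w ∈ W, ∃ n : ℕ, x = w ^ n}

theorem pow_mem_powSpan {A : Type*} [CommRing A] [Algebra ℝ A] {W : Submodule ℝ A} {w : A}
    (hw : w ∈ W) (n : ℕ) : w ^ n ∈ powSpan W :=
  Submodule.subset_span ⟨w, hw, n, rfl⟩

theorem pow_mul_pow_mem_powSpan {A : Type*} [CommRing A] [Algebra ℝ A] {W : Submodule ℝ A}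
    {u v : A} (hu : u ∈ W) (hv : v ∈ W) (k n : ℕ) : u ^ k * v ^ n ∈ powSpan W := by
  have h := coeff_mem_of_forall_sum_pow_smul_mem (powSpan W) (N := k + n + 1)
    (fun i => ((k + n).choose i : ℝ) • (u ^ (i : ℕ) * v ^ (k + n - i))) (fun r => by
      have := pow_mem_powSpan (W.add_mem (W.smul_mem r hu) hv) (k + n)
      rw [add_pow, Finset.sum_range] at this
      convert this using 2 with i
      rw [smul_pow, smul_mul_assoc, smul_mul_assoc, Algebra.smul_def (((k + n).choose i : ℕ) : ℝ),
        map_natCast, mul_comm (((k + n).choose i : ℕ) : A)]) ⟨k, by omega⟩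
  have hne : ((k + n).choose k : ℝ) ≠ 0 := by
    exact_mod_cast (Nat.choose_pos (Nat.le_add_right k n)).ne'
  have h2 := (powSpan W).smul_mem (((k + n).choose k : ℝ))⁻¹ h
  simpa [smul_smul, inv_mul_cancel₀ hne] using h2

theorem mul_mem_powSpan {A : Type*} [CommRing A] [Algebra ℝ A] {W : Submodule ℝ A}
    {x y : A} (hx : x ∈ powSpan W) (hy : y ∈ powSpan W) : x * y ∈ powSpan W := by
  have h : powSpan W * powSpan W ≤ powSpan W := by
    unfold powSpan
    rw [Submodule.span_mul_span, Submodule.span_le]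
    rintro _ ⟨_, ⟨w, hw, n, rfl⟩, _, ⟨w', hw', n', rfl⟩, rfl⟩
    exact pow_mul_pow_mem_powSpan hw hw' n n'
  exact h (Submodule.mul_mem_mul hx hy)

/-- The powers of elements of `W` span a subalgebra. -/
def powSpanSubalgebra {A : Type*} [CommRing A] [Algebra ℝ A] (W : Submodule ℝ A) :
    Subalgebra ℝ A :=
  (powSpan W).toSubalgebra (by simpa using pow_mem_powSpan W.zero_mem 0)
    (fun _ _ => mul_mem_powSpan)

theorem mem_powSpanSubalgebra {A : Type*} [CommRing A] [Algebra ℝ A] {W : Submodule ℝ A} {x : A} :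
    x ∈ powSpanSubalgebra W ↔ x ∈ powSpan W := Iff.rfl

/-- Every polynomial is the derivative of a polynomial. -/
theorem Polynomial.exists_derivative_eq (Q : Polynomial ℝ) :
    ∃ P : Polynomial ℝ, P.derivative = Q := by
  induction Q using Polynomial.induction_on' with
  | add p q hp hq =>
    obtain ⟨P, rfl⟩ := hp
    obtain ⟨R, rfl⟩ := hq
    exact ⟨P + R, Polynomial.derivative_add⟩
  | monomial n a =>
    refine ⟨Polynomial.monomial (n + 1) (a / (n + 1)), ?_⟩
    rw [Polynomial.derivative_monomial]
    have : ((n : ℝ) + 1) ≠ 0 := by positivity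
    congr 1
    push_cast
    field_simp

theorem Polynomial.degree_lt_succ_of_degree_derivative_lt {P : Polynomial ℝ} {n : ℕ}
    (h : P.derivative.degree < n) : P.degree < (n + 1 : ℕ) := by
  rcases Nat.eq_zero_or_pos P.natDegree with h0 | h0
  · rw [Polynomial.eq_C_of_natDegree_eq_zero h0]
    exact Polynomial.degree_C_le.trans_lt (by exact_mod_cast Nat.succ_pos n)
  · rw [Polynomial.degree_derivative h0.ne'] at h
    have h' : P.natDegree - 1 < n := by exact_mod_cast h
    exact Polynomial.degree_le_natDegree.trans_lt (by exact_mod_cast (by omega : P.natDegree < n + 1))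

theorem exists_polynomial_of_deriv_eq {f : ℝ → ℝ} (hf : Differentiable ℝ f) {Q : Polynomial ℝ}
    (hQ : ∀ y, deriv f y = Q.eval y) :
    ∃ P : Polynomial ℝ, P.derivative = Q ∧ ∀ y, f y = P.eval y := by
  obtain ⟨P, rfl⟩ := Q.exists_derivative_eq
  refine ⟨P + Polynomial.C (f 0 - P.eval 0), by simp, fun y => ?_⟩
  have h := is_const_of_deriv_eq_zero (f := fun y => f y - P.eval y)
    (hf.sub P.differentiable) (fun x => by
      rw [deriv_fun_sub (hf x) P.differentiableAt, hQ, Polynomial.deriv, sub_self]) y 0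
  simp only [Polynomial.eval_add, Polynomial.eval_C]
  linarith

theorem exists_polynomial_of_iteratedDeriv_eq_zero (n : ℕ) {f : ℝ → ℝ}
    (hf : ContDiff ℝ (⊤ : ℕ∞) f) (h : ∀ y, iteratedDeriv n f y = 0) :
    ∃ P : Polynomial ℝ, P.degree < n ∧ ∀ y, f y = P.eval y := by
  induction n generalizing f with
  | zero => exact ⟨0, by simp, fun y => by simpa using h y⟩
  | succ n ih =>
    obtain ⟨Q, hQ, hQf⟩ := ih (f := deriv f) (contDiff_infty_iff_deriv.mp hf).2
      (fun y => by rw [← iteratedDeriv_succ']; exact h y)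
    obtain ⟨P, rfl, hP⟩ := exists_polynomial_of_deriv_eq (contDiff_infty_iff_deriv.mp hf).1 hQf
    exact ⟨P, Polynomial.degree_lt_succ_of_degree_derivative_lt hQ, hP⟩

/-- A pointwise limit of polynomials of bounded degree is a polynomial. -/
theorem exists_polynomial_of_tendsto {n : ℕ} {f : ℕ → ℝ → ℝ} {g : ℝ → ℝ}
    (hf : ∀ k, ∃ P : Polynomial ℝ, P.degree < n ∧ ∀ y, f k y = P.eval y)
    (hg : ∀ y, Tendsto (fun k => f k y) atTop (𝓝 (g y))) :
    ∃ P : Polynomial ℝ, ∀ y, g y = P.eval y := by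
  let ev : Polynomial.degreeLT ℝ n →ₗ[ℝ] (ℝ → ℝ) :=
    { toFun := fun P y => (P : Polynomial ℝ).eval y
      map_add' := fun P Q => by ext y; simp
      map_smul' := fun r P => by ext y; simp }
  have hfin : FiniteDimensional ℝ (Polynomial.degreeLT ℝ n) :=
    Module.Finite.equiv (Polynomial.degreeLTEquiv ℝ n).symm
  have hcl : IsClosed (LinearMap.range ev : Set (ℝ → ℝ)) :=
    Submodule.closed_of_finiteDimensional _
  obtain ⟨P, hP⟩ := hcl.mem_of_tendsto (tendsto_pi_nhds.mpr hg) (Eventually.of_forall fun k => by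
    obtain ⟨P, hP, hPf⟩ := hf k
    exact ⟨⟨P, Polynomial.mem_degreeLT.mpr hP⟩, (funext hPf).symm⟩)
  exact ⟨P, fun y => (congrFun hP y).symm⟩

end

section

theorem integral_mem_of_isClosed_submodule {E : Type*} [NormedAddCommGroup E] [NormedSpace ℝ E]
    [CompleteSpace E] {M : Submodule ℝ E} (hM : IsClosed (M : Set E)) {F : ℝ → E}
    (hF : Integrable F) (h : ∀ t, F t ∈ M) : ∫ t, F t ∈ M := by
  have : IsClosed (M : Set E) := hM
  have h1 := M.mkQL.integral_comp_comm hF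
  have h2 : ∀ t, M.mkQL (F t) = 0 := fun t => by simpa using h t
  simp only [h2, integral_zero] at h1
  simpa using h1.symm

/-- A pointwise derivative that is jointly continuous is a derivative in the supremum norm. -/
theorem hasDerivAt_continuousMap {X : Type*} [TopologicalSpace X] [CompactSpace X]
    {F F' : ℝ → C(X, ℝ)} (hF' : Continuous F')
    (h : ∀ r x, HasDerivAt (fun r => F r x) (F' r x) r) (r : ℝ) : HasDerivAt F (F' r) r := by
  have key : ∀ r, F r = F 0 + ∫ t in (0:ℝ)..r, F' t := by
    intro r
    ext x
    have h1 := (ContinuousMap.evalCLM ℝ x).intervalIntegral_comp_comm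
      (hF'.intervalIntegrable (μ := volume) 0 r)
    simp only [ContinuousMap.evalCLM_apply] at h1
    rw [ContinuousMap.add_apply, ← h1, intervalIntegral.integral_eq_sub_of_hasDerivAt
      (fun t _ => h t x) (((ContinuousMap.evalCLM ℝ x).continuous.comp hF').intervalIntegrable 0 r)]
    ring
  have h2 : HasDerivAt (fun r => F 0 + ∫ t in (0:ℝ)..r, F' t) (F' r) r :=
    (hF'.integral_hasStrictDerivAt 0 r).hasDerivAt.const_add _
  exact h2.congr_of_eventuallyEq (Eventually.of_forall key)

theorem deriv_mem_of_isClosed_submodule {E : Type*} [NormedAddCommGroup E] [NormedSpace ℝ E]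
    {M : Submodule ℝ E} (hM : IsClosed (M : Set E)) {F : ℝ → E} {F' : E} {r : ℝ}
    (hF : HasDerivAt F F' r) (h : ∀ t, F t ∈ M) : F' ∈ M := by
  have h1 := hF.tendsto_slope
  refine hM.mem_of_tendsto h1 (Eventually.of_forall fun t => ?_)
  rw [slope_def_module]
  exact M.smul_mem _ (M.sub_mem (h t) (h r))

section Ridge

variable {X : Type*} [TopologicalSpace X]

/-- The ridge function `x ↦ g (r * w x + c)`. -/
def ridge (g : C(ℝ, ℝ)) (w : C(X, ℝ)) (r c : ℝ) : C(X, ℝ) :=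
  g.comp (r • w + ContinuousMap.const X c)

@[simp]
theorem ridge_apply (g : C(ℝ, ℝ)) (w : C(X, ℝ)) (r c : ℝ) (x : X) :
    ridge g w r c x = g (r * w x + c) := rfl

theorem continuous_ridge (g : C(ℝ, ℝ)) (w : C(X, ℝ)) :
    Continuous (fun p : ℝ × ℝ => ridge g w p.1 p.2) := by
  apply ContinuousMap.continuous_of_continuous_uncurry
  simp only [ridge_apply, Function.uncurry_def]
  fun_prop

variable [CompactSpace X]

theorem pow_mul_iteratedDeriv_mem {M : Submodule ℝ C(X, ℝ)} (hM : IsClosed (M : Set C(X, ℝ)))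
    (w : C(X, ℝ)) {g : ℝ → ℝ} (hg : ContDiff ℝ (⊤ : ℕ∞) g)
    (h : ∀ r c, ridge ⟨g, hg.continuous⟩ w r c ∈ M) (n : ℕ) (r c : ℝ) :
    w ^ n * ridge ⟨iteratedDeriv n g, hg.continuous_iteratedDeriv n (by exact_mod_cast le_top)⟩
      w r c ∈ M := by
  induction n generalizing r with
  | zero => simpa using h r c
  | succ n ih =>
    refine deriv_mem_of_isClosed_submodule hM (r := r) (hasDerivAt_continuousMap
      (F' := fun r => w ^ (n + 1) * ridge ⟨iteratedDeriv (n + 1) g,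
        hg.continuous_iteratedDeriv (n + 1) (by exact_mod_cast le_top)⟩ w r c) ?_ ?_ r) ih
    · exact continuous_const.mul ((continuous_ridge _ w).comp (Continuous.prodMk_left c))
    · intro r x
      have hd : HasDerivAt (iteratedDeriv n g) (iteratedDeriv (n + 1) g (r * w x + c))
          (r * w x + c) := by
        rw [iteratedDeriv_succ]
        exact ((hg.differentiable_iteratedDeriv n
          (by exact_mod_cast WithTop.coe_lt_top n)) _).hasDerivAt
      have hl : HasDerivAt (fun r : ℝ => r * w x + c) (w x) r := by
        simpa using ((hasDerivAt_id r).mul_const (w x)).add_const c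
      have := (hd.comp r hl).const_mul ((w x) ^ n)
      simp only [ContinuousMap.mul_apply, ContinuousMap.pow_apply, ridge_apply,
        ContinuousMap.coe_mk]
      exact this.congr_deriv (by ring)

theorem ridge_convolution_mem {M : Submodule ℝ C(X, ℝ)} (hM : IsClosed (M : Set C(X, ℝ)))
    (w : C(X, ℝ)) {g : C(ℝ, ℝ)} (h : ∀ r c, ridge g w r c ∈ M) {φ : ℝ → ℝ} (hφ : Continuous φ)
    (hφc : HasCompactSupport φ) {G : ℝ → ℝ} (hG : Continuous G)
    (hGφ : ∀ x, G x = ∫ t, φ t * g (x - t)) (r c : ℝ) : ridge ⟨G, hG⟩ w r c ∈ M := by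
  have hcont : Continuous (fun t => φ t • ridge g w r (c - t)) :=
    hφ.smul ((continuous_ridge g w).comp (continuous_const.prodMk (continuous_const.sub continuous_id)))
  have h_int : Integrable (fun t => φ t • ridge g w r (c - t)) :=
    hcont.integrable_of_hasCompactSupport hφc.smul_right
  have : ridge ⟨G, hG⟩ w r c = ∫ t, φ t • ridge g w r (c - t) := by
    ext x
    have h1 := (ContinuousMap.evalCLM ℝ x).integral_comp_comm h_int
    simp only [ContinuousMap.evalCLM_apply] at h1
    rw [← h1]
    simp [hGφ, add_sub_assoc]
  rw [this]
  exact integral_mem_of_isClosed_submodule hM h_int fun t => M.smul_mem _ (h _ _)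

theorem pow_mem_of_ridge_mem {M : Submodule ℝ C(X, ℝ)} (hM : IsClosed (M : Set C(X, ℝ)))
    (w : C(X, ℝ)) {g : C(ℝ, ℝ)} (hg : ¬ ∃ P : Polynomial ℝ, ∀ y, g y = P.eval y)
    (h : ∀ r c, ridge g w r c ∈ M) (n : ℕ) : w ^ n ∈ M := by
  let φ : ℕ → ContDiffBump (0 : ℝ) := fun k => ⟨1 / (k + 2), 1 / (k + 1), by positivity,
    one_div_lt_one_div_of_lt (by positivity) (by linarith)⟩
  let G : ℕ → ℝ → ℝ := fun k =>
    MeasureTheory.convolution ((φ k).normed volume) g (ContinuousLinearMap.lsmul ℝ ℝ) volume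
  have hG : ∀ k, ContDiff ℝ (⊤ : ℕ∞) (G k) := fun k =>
    (φ k).hasCompactSupport_normed.contDiff_convolution_left _ (φ k).contDiff_normed
      g.continuous.locallyIntegrable
  by_contra hn
  refine hg (exists_polynomial_of_tendsto (n := n) (f := G) (fun k => ?_) fun y => ?_)
  · refine exists_polynomial_of_iteratedDeriv_eq_zero n (hG k) fun y => ?_
    by_contra hy
    have h1 := pow_mul_iteratedDeriv_mem hM w (hG k) (fun r c => ridge_convolution_mem hM w h
      (φ := (φ k).normed volume) (φ k).continuous_normed (φ k).hasCompactSupport_normed (hG k).continuous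
        (fun x => by simp [G, MeasureTheory.convolution_def]) r c) n 0 y
    have h2 := M.smul_mem (iteratedDeriv n (G k) y)⁻¹ h1
    refine hn ?_
    convert h2 using 1
    ext x
    simp
    field_simp
  · exact ContDiffBump.convolution_tendsto_right_of_continuous
      (by simpa [φ] using tendsto_one_div_add_atTop_nhds_zero_nat (𝕜 := ℝ)) g.continuous y

end Ridge

end

section

/-- Universal approximation in two variables by ridge functions whose coefficient of the second
variable is nonzero. -/
theorem closure_span_ridge_eq_top {K : Set (ℝ × ℝ)} [CompactSpace K] {g : C(ℝ, ℝ)}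
    (hg : ¬ ∃ P : Polynomial ℝ, ∀ y, g y = P.eval y) :
    (Submodule.span ℝ {f : C(K, ℝ) | ∃ a b c : ℝ, a ≠ 0 ∧
      ∀ x : K, f x = g (a * x.1.2 + b * x.1.1 + c)}).topologicalClosure = ⊤ := by
  set S : Set C(K, ℝ) := {f : C(K, ℝ) | ∃ a b c : ℝ, a ≠ 0 ∧
      ∀ x : K, f x = g (a * x.1.2 + b * x.1.1 + c)} with hS
  set M := (Submodule.span ℝ S).topologicalClosure with hM
  have hMc : IsClosed (M : Set C(K, ℝ)) := Submodule.isClosed_topologicalClosure _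
  let s : C(K, ℝ) := ⟨fun x => x.1.1, by fun_prop⟩
  let u : C(K, ℝ) := ⟨fun x => x.1.2, by fun_prop⟩
  have hmem : ∀ a b c : ℝ, ridge g (a • u + b • s) 1 c ∈ M := by
    intro a b c
    let F : ℝ → C(K, ℝ) := fun a => ridge g (a • u + b • s) 1 c
    have hF : Continuous F := by
      apply ContinuousMap.continuous_of_continuous_uncurry
      simp only [F, ridge_apply, Function.uncurry_def, ContinuousMap.add_apply,
        ContinuousMap.smul_apply]
      fun_prop
    have hcl : IsClosed (F ⁻¹' (M : Set C(K, ℝ))) := hMc.preimage hF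
    have hsub : ({0}ᶜ : Set ℝ) ⊆ F ⁻¹' (M : Set C(K, ℝ)) := by
      intro a ha
      refine Submodule.le_topologicalClosure _ (Submodule.subset_span ⟨a, b, c, ha, fun x => ?_⟩)
      simp [F, s, u]
    have := hcl.closure_subset_iff.mpr hsub
    rw [(dense_compl_singleton (0:ℝ)).closure_eq] at this
    exact this (mem_univ a)
  have hpow : powSpan (Submodule.span ℝ {u, s}) ≤ M := by
    refine Submodule.span_le.mpr ?_
    rintro _ ⟨w, hw, n, rfl⟩
    obtain ⟨a, b, rfl⟩ := Submodule.mem_span_pair.mp hw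
    refine pow_mem_of_ridge_mem hMc _ hg (fun r c => ?_) n
    convert hmem (r * a) (r * b) c using 1
    ext x
    simp [s, u]
    ring_nf
  have htop := ContinuousMap.subalgebra_topologicalClosure_eq_top_of_separatesPoints
    (powSpanSubalgebra (Submodule.span ℝ {u, s})) (fun x y hxy => by
      by_cases h1 : x.1.1 = y.1.1
      · have h2 : x.1.2 ≠ y.1.2 := fun h2 => hxy (Subtype.ext (Prod.ext h1 h2))
        refine ⟨_, ⟨u, ?_, rfl⟩, h2⟩
        have := pow_mem_powSpan (W := Submodule.span ℝ {u, s})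
          (Submodule.subset_span (by simp : u ∈ ({u, s} : Set C(K, ℝ)))) 1
        simpa [mem_powSpanSubalgebra] using this
      · refine ⟨_, ⟨s, ?_, rfl⟩, h1⟩
        have := pow_mem_powSpan (W := Submodule.span ℝ {u, s})
          (Submodule.subset_span (by simp : s ∈ ({u, s} : Set C(K, ℝ)))) 1
        simpa [mem_powSpanSubalgebra] using this)
  rw [eq_top_iff]
  intro f _
  have hf : f ∈ (powSpanSubalgebra (Submodule.span ℝ {u, s})).topologicalClosure := by
    rw [htop]; trivial
  rw [← SetLike.mem_coe, Subalgebra.topologicalClosure_coe] at hf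
  exact hMc.closure_subset_iff.mpr hpow hf

variable {d : ℕ}

theorem HasGradientAt.fun_add {f g : Vec d → ℝ} {f' g' y : Vec d} (hf : HasGradientAt f f' y)
    (hg : HasGradientAt g g' y) : HasGradientAt (fun y => f y + g y) (f' + g') y := by
  have := HasFDerivAt.add hf.hasFDerivAt hg.hasFDerivAt
  rw [← map_add] at this
  exact hasGradientAt_iff_hasFDerivAt.mpr this

theorem HasGradientAt.fun_const_mul {f : Vec d → ℝ} {f' y : Vec d} (hf : HasGradientAt f f' y)
    (r : ℝ) : HasGradientAt (fun y => r * f y) (r • f') y := by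
  have := hf.hasFDerivAt.const_mul r
  rw [hasGradientAt_iff_hasFDerivAt, map_smul]
  exact this

/-- `V` is a shallow network with (continuous) spatial gradient `G`. -/
structure IsShallowGradient (σ : ℝ → ℝ) (V : ℝ → Vec d → ℝ) (G : ℝ → Vec d → Vec d) : Prop where
  shallow : ShallowClass σ V
  gradient : ∀ s y, HasGradientAt (V s) (G s y) y
  continuous : Continuous (fun p : ℝ × Vec d => G p.1 p.2)

theorem IsShallowGradient.zero (σ : ℝ → ℝ) :
    IsShallowGradient σ (fun _ (_ : Vec d) => 0) (fun _ _ => 0) where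
  shallow := ⟨0, 0, 0, 0, 0, by simp⟩
  gradient := fun s y => hasGradientAt_const y 0
  continuous := continuous_const

theorem ShallowClass.add {σ : ℝ → ℝ} {V V' : ℝ → Vec d → ℝ} (h : ShallowClass σ V)
    (h' : ShallowClass σ V') : ShallowClass σ (fun s y => V s y + V' s y) := by
  obtain ⟨n, A, b, c, w, h⟩ := h
  obtain ⟨n', A', b', c', w', h'⟩ := h'
  refine ⟨n + n', fun i j => Fin.append (fun i => A i j) (fun i => A' i j) i, Fin.append b b', Fin.append c c',
    Fin.append w w', fun s y => ?_⟩
  simp [h, h', Fin.sum_univ_add]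

theorem IsShallowGradient.add {σ : ℝ → ℝ} {V V' : ℝ → Vec d → ℝ} {G G' : ℝ → Vec d → Vec d}
    (h : IsShallowGradient σ V G) (h' : IsShallowGradient σ V' G') :
    IsShallowGradient σ (fun s y => V s y + V' s y) (fun s y => G s y + G' s y) where
  shallow := h.shallow.add h'.shallow
  gradient := fun s y => (h.gradient s y).fun_add (h'.gradient s y)
  continuous := h.continuous.add h'.continuous

theorem isShallowGradient_ridge {σ : ℝ → ℝ} (hσ : ContDiff ℝ 1 σ) (α : Vec d) {a : ℝ}
    (ha : a ≠ 0) (b c r : ℝ) :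
    IsShallowGradient σ (fun s y => (r / a) * σ (a * inner ℝ α y + b * s + c))
      (fun s y => (r * deriv σ (a * inner ℝ α y + b * s + c)) • α) where
  shallow := ⟨1, Matrix.of fun _ j => a * α j, fun _ => b, fun _ => c, fun _ => r / a, fun s y => by
    simp [PiLp.inner_apply, Finset.mul_sum, mul_assoc, mul_comm]⟩
  gradient := fun s y => by
    rw [hasGradientAt_iff_hasFDerivAt]
    have h1 : HasFDerivAt (fun y : Vec d => a * inner ℝ α y + b * s + c) (a • innerSL ℝ α) y :=
      (((innerSL ℝ α).hasFDerivAt.const_mul a).add_const _).add_const _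
    have h2 := (((hσ.differentiable one_ne_zero)
      (a * inner ℝ α y + b * s + c)).hasDerivAt.comp_hasFDerivAt y h1).const_mul (r / a)
    refine h2.congr_fderiv ?_
    ext v
    simp
    field_simp
  continuous := by
    have := hσ.continuous_deriv le_rfl
    fun_prop

/-- Ridge-type gradient fields are approximated by gradients of shallow networks. -/
theorem exists_isShallowGradient_near_ridge {σ : ℝ → ℝ} (hσ : ContDiff ℝ 1 σ)
    (hσp : ¬ ∃ P : Polynomial ℝ, ∀ y : ℝ, σ y = P.eval y) (α : Vec d) {g : ℝ → ℝ → ℝ}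
    (hg : Continuous (fun p : ℝ × ℝ => g p.1 p.2)) (R : ℝ) {δ : ℝ} (hδ : 0 < δ) :
    ∃ V G, IsShallowGradient σ V G ∧ ∀ s ∈ Icc (0:ℝ) 1, ∀ y : Vec d, ‖y‖ ≤ R →
      ‖G s y - g s (inner ℝ α y) • α‖ ≤ δ := by
  let K : Set (ℝ × ℝ) := Icc 0 1 ×ˢ Icc (-(‖α‖ * R)) (‖α‖ * R)
  have hK : CompactSpace K := isCompact_iff_compactSpace.mp (isCompact_Icc.prod isCompact_Icc)
  let τ : C(ℝ, ℝ) := ⟨deriv σ, hσ.continuous_deriv le_rfl⟩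
  have hτ : ¬ ∃ P : Polynomial ℝ, ∀ y, τ y = P.eval y := by
    rintro ⟨P, hP⟩
    obtain ⟨Q, -, hQ⟩ := exists_polynomial_of_deriv_eq (hσ.differentiable one_ne_zero) hP
    exact hσp ⟨Q, hQ⟩
  let f : C(K, ℝ) := ⟨fun x => g x.1.1 x.1.2, hg.comp continuous_subtype_val⟩
  have hf : f ∈ (Submodule.span ℝ {f : C(K, ℝ) | ∃ a b c : ℝ, a ≠ 0 ∧
      ∀ x : K, f x = τ (a * x.1.2 + b * x.1.1 + c)}).topologicalClosure := by
    rw [closure_span_ridge_eq_top hτ]; trivial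
  have hδ' : 0 < δ / (‖α‖ + 1) := by positivity
  rw [← SetLike.mem_coe, Submodule.topologicalClosure_coe, Metric.mem_closure_iff] at hf
  obtain ⟨f', hf', hff'⟩ := hf _ hδ'
  have key : ∃ V G, IsShallowGradient σ V G ∧ ∀ (x : K) (y : Vec d), x.1.2 = inner ℝ α y →
      G x.1.1 y = f' x • α := by
    clear hff'
    induction hf' using Submodule.span_induction with
    | mem x hx =>
      obtain ⟨a, b, c, ha, hx⟩ := hx
      refine ⟨_, _, isShallowGradient_ridge hσ α ha b c 1, fun z y hz => ?_⟩
      rw [hx, hz, one_mul]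
      rfl
    | zero => exact ⟨_, _, IsShallowGradient.zero σ, fun _ _ _ => by simp⟩
    | add x x' _ _ h h' =>
      obtain ⟨V, G, h1, h2⟩ := h
      obtain ⟨V', G', h1', h2'⟩ := h'
      exact ⟨_, _, h1.add h1', fun z y hz => by
        rw [h2 z y hz, h2' z y hz, ContinuousMap.add_apply, add_smul]⟩
    | smul r x _ h =>
      obtain ⟨V, G, ⟨h1, h2, h3⟩, h4⟩ := h
      refine ⟨fun s y => r * V s y, fun s y => r • G s y, ⟨?_, ?_, ?_⟩, fun z y hz => ?_⟩
      · obtain ⟨n, A, b, c, w, h⟩ := h1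
        exact ⟨n, A, b, c, fun i => r * w i, fun s y => by simp [h, Finset.mul_sum, mul_assoc]⟩
      · intro s y
        exact (h2 s y).fun_const_mul r
      · exact h3.const_smul r
      · simp only [h4 z y hz, ContinuousMap.smul_apply, smul_eq_mul, mul_smul]
  obtain ⟨V, G, hVG, hG⟩ := key
  refine ⟨V, G, hVG, fun s hs y hy => ?_⟩
  have hin : |inner ℝ α y| ≤ ‖α‖ * R :=
    (abs_real_inner_le_norm α y).trans (by gcongr)
  let x : K := ⟨(s, inner ℝ α y), hs, abs_le.mp hin⟩
  have h1 := hG x y rfl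
  have h2 : |f x - f' x| ≤ δ / (‖α‖ + 1) :=
    (ContinuousMap.dist_apply_le_dist x).trans hff'.le
  change G s y = _ at h1
  rw [h1, ← sub_smul, norm_smul, Real.norm_eq_abs, abs_sub_comm]
  change |f x - f' x| * ‖α‖ ≤ δ
  calc |f x - f' x| * ‖α‖ ≤ δ / (‖α‖ + 1) * (‖α‖ + 1) := by gcongr; linarith
    _ = δ := by field_simp

end

section ODE

variable {E : Type*} [NormedAddCommGroup E] [NormedSpace ℝ E] [FiniteDimensional ℝ E]

/-- Global solvability on `[0, 1]` for compactly supported `C¹` vector fields. -/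
theorem exists_hasDerivWithinAt_of_contDiff {F : ℝ × E → E} (hF : ContDiff ℝ 1 F)
    (hc : HasCompactSupport F) (x₀ : E) :
    ∃ y : ℝ → E, y 0 = x₀ ∧
      ∀ t ∈ Icc (0 : ℝ) 1, HasDerivWithinAt y (F (t, y t)) (Icc 0 1) t := by
  obtain ⟨C, hC⟩ := hF.lipschitzWith_of_hasCompactSupport hc one_ne_zero
  obtain ⟨M, hM⟩ := hc.exists_bound_of_continuous hF.continuous
  have hM0 : 0 ≤ M := (norm_nonneg _).trans (hM (0, 0))
  have : IsPicardLindelof (fun t x => F (t, x)) (⟨0, by simp⟩ : Icc (0 : ℝ) 1) x₀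
      ⟨M, hM0⟩ 0 ⟨M, hM0⟩ C := by
    refine ⟨fun t _ => ?_, fun x _ => ?_, fun t _ x _ => hM _, ?_⟩
    · refine (LipschitzWith.of_dist_le_mul fun x x' => ?_).lipschitzOnWith
      refine (hC.dist_le_mul _ _).trans_eq ?_
      simp [Prod.dist_eq]
    · exact (hF.continuous.comp (by fun_prop)).continuousOn
    · simp
  exact this.exists_eq_forall_mem_Icc_hasDerivWithinAt₀

/-- **Peano's theorem** for continuous, compactly supported vector fields. -/
theorem exists_hasDerivWithinAt_of_continuous {F : ℝ × E → E} (hF : Continuous F)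
    (hc : HasCompactSupport F) (x₀ : E) :
    ∃ y : ℝ → E, y 0 = x₀ ∧
      ∀ t ∈ Icc (0 : ℝ) 1, HasDerivWithinAt y (F (t, y t)) (Icc 0 1) t := by
  obtain ⟨M, hM⟩ := hc.exists_bound_of_continuous hF
  have hM0 : 0 ≤ M := (norm_nonneg _).trans (hM (0, 0))
  have hG : ∀ k : ℕ, ∃ G : ℝ × E → E, ContDiff ℝ 1 G ∧
      (∀ x, dist (G x) (F x) < 1 / ((k : ℝ) + 1)) ∧ Function.support G ⊆ Function.support F :=
    fun k => hF.exists_contDiff_approx 1 continuous_const fun _ => by positivity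
  choose G hGs hGF hGsupp using hG
  have hGM : ∀ k x, ‖G k x‖ ≤ M + 1 := fun k x => by
    have h1 : ‖G k x - F x‖ ≤ 1 := by
      rw [← dist_eq_norm]
      refine (hGF k x).le.trans ?_
      rw [div_le_one (by positivity)]
      linarith [(Nat.cast_nonneg k : (0 : ℝ) ≤ k)]
    linarith [norm_le_norm_add_norm_sub' (G k x) (F x), hM x]
  choose y hy0 hy using fun k =>
    exists_hasDerivWithinAt_of_contDiff (hGs k) (hc.mono (hGsupp k)) x₀
  have hlip : ∀ k, LipschitzOnWith ⟨M + 1, by linarith⟩ (y k) (Icc 0 1) := fun k =>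
    (convex_Icc (0 : ℝ) 1).lipschitzOnWith_of_nnnorm_hasDerivWithin_le (hy k)
      fun t _ => hGM k _
  let u : ℕ → BoundedContinuousFunction (Icc (0 : ℝ) 1) E := fun k =>
    BoundedContinuousFunction.mkOfCompact
      ⟨(Icc (0 : ℝ) 1).domRestrict (y k), (hlip k).continuousOn.domRestrict⟩
  have hcomp : IsCompact (closure (range u)) := by
    refine BoundedContinuousFunction.arzela_ascoli (Metric.closedBall x₀ (M + 1))
      (isCompact_closedBall _ _) _ ?_ ?_
    · rintro _ t ⟨k, rfl⟩
      change y k t ∈ _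
      have := (hlip k).dist_le_mul t t.2 0 (by simp)
      rw [hy0] at this
      refine this.trans ?_
      change (M + 1) * _ ≤ _
      have ht := t.2
      have : dist (t : ℝ) 0 ≤ 1 := by simp [abs_le]; constructor <;> linarith [ht.1, ht.2]
      nlinarith
    · refine (LipschitzWith.uniformEquicontinuous _ ⟨M + 1, by linarith⟩ ?_).equicontinuous
      rintro ⟨_, k, rfl⟩
      exact (hlip k).to_restrict
  obtain ⟨f, -, φ, hφ, hlim⟩ := hcomp.tendsto_subseq fun k => subset_closure (mem_range_self (f := u) k)
  let pr : ℝ → Icc (0 : ℝ) 1 := projIcc 0 1 zero_le_one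
  have hpr : Continuous pr := continuous_projIcc
  have hprm : ∀ t (ht : t ∈ Icc (0 : ℝ) 1), pr t = ⟨t, ht⟩ := fun t ht => projIcc_of_mem _ ht
  have hYc : ∀ k, Continuous fun t => u k (pr t) := fun k => (u k).continuous.comp hpr
  have hyc : Continuous fun t => f (pr t) := f.continuous.comp hpr
  have hpt : ∀ t, Tendsto (fun k => u (φ k) (pr t)) atTop (𝓝 (f (pr t))) := fun t =>
    ((BoundedContinuousFunction.lipschitz_eval_const (pr t)).continuous.tendsto f).comp hlim
  have hYy : ∀ k, ∀ t ∈ Icc (0 : ℝ) 1, u k (pr t) = y k t := fun k t ht => by rw [hprm t ht]; rfl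
  have heq : ∀ k, ∀ t ∈ Icc (0 : ℝ) 1,
      u k (pr t) = x₀ + ∫ τ in (0 : ℝ)..t, G k (τ, u k (pr τ)) := by
    intro k t ht
    have hsub : uIcc 0 t ⊆ Icc (0 : ℝ) 1 := by
      rw [uIcc_of_le ht.1]; exact Icc_subset_Icc le_rfl ht.2
    have := ODE.picard_eq_of_hasDerivAt (f := fun t x => G k (t, x)) (α := y k) (t₀ := 0) (t := t)
      (u := univ) (hGs k).continuous.continuousOn
      (fun t' ht' => (hy k t' (hsub ht')).mono hsub) (mapsTo_univ _ _)
    rw [hYy k t ht, ← this, ODE.picard_apply, hy0]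
    congr 1
    refine intervalIntegral.integral_congr fun τ hτ => ?_
    simp only [hYy k τ (hsub hτ)]
  have hlimeq : ∀ t ∈ Icc (0 : ℝ) 1, f (pr t) = x₀ + ∫ τ in (0 : ℝ)..t, F (τ, f (pr τ)) := by
    intro t ht
    refine tendsto_nhds_unique (hpt t) ?_
    simp_rw [heq _ t ht]
    refine Tendsto.const_add _ ?_
    refine intervalIntegral.tendsto_integral_filter_of_dominated_convergence (fun _ => M + 1)
      (.of_forall fun k => ?_) (.of_forall fun k => .of_forall fun τ _ => hGM _ _)
      intervalIntegrable_const (.of_forall fun τ _ => ?_)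
    · have := hYc (φ k)
      exact ((hGs (φ k)).continuous.comp (by fun_prop)).aestronglyMeasurable
    · have h1 : Tendsto (fun k => F (τ, u (φ k) (pr τ))) atTop (𝓝 (F (τ, f (pr τ)))) :=
        (hF.tendsto _).comp (tendsto_const_nhds.prodMk_nhds (hpt τ))
      refine (tendsto_iff_of_dist ?_).2 h1
      refine squeeze_zero (fun _ => dist_nonneg) (fun k => (hGF (φ k) _).le) ?_
      exact (tendsto_one_div_add_atTop_nhds_zero_nat (𝕜 := ℝ)).comp hφ.tendsto_atTop
  refine ⟨fun t => f (pr t), ?_, fun t ht => ?_⟩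
  · simpa using hlimeq 0 (by simp)
  · have h := ODE.hasDerivWithinAt_picard_Icc (f := fun t x => F (t, x)) (u := univ)
      (α := fun t => f (pr t)) (t₀ := 0) (tmin := 0) (tmax := 1)
      (by simp) hF.continuousOn hyc.continuousOn (fun _ _ => mem_univ _) x₀ ht
    exact h.congr_of_mem (fun s hs => by rw [ODE.picard_apply]; exact hlimeq s hs) ht

/-- Solutions of a `C¹` equation on `[0, 1]` persist under small continuous perturbations of the
vector field. -/
theorem exists_perturbed_solution {X : ℝ × E → E} (hX : ContDiff ℝ 1 X) (R : ℝ) {ε : ℝ}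
    (hε : 0 < ε) : ∃ δ > 0, ∀ Y : ℝ × E → E, Continuous Y →
      (∀ s ∈ Icc (0 : ℝ) 1, ∀ x, ‖x‖ ≤ |R| + 2 → ‖Y (s, x) - X (s, x)‖ ≤ δ) →
      ∀ z : ℝ → E, (∀ s ∈ Icc (0 : ℝ) 1, HasDerivWithinAt z (X (s, z s)) (Icc 0 1) s) →
      (∀ s ∈ Icc (0 : ℝ) 1, ‖z s‖ ≤ R) →
      ∃ y : ℝ → E, y 0 = z 0 ∧
        (∀ s ∈ Icc (0 : ℝ) 1, HasDerivWithinAt y (Y (s, y s)) (Icc 0 1) s) ∧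
        ∀ s ∈ Icc (0 : ℝ) 1, ‖y s - z s‖ ≤ ε := by
  let χ : ContDiffBump (0 : ℝ × E) :=
    ⟨|R| + 1, |R| + 2, by positivity, by linarith⟩
  have hR0 := abs_nonneg R
  have hχ1 : ∀ s ∈ Icc (0 : ℝ) 1, ∀ x, ‖x‖ ≤ |R| + 1 → χ (s, x) = 1 := fun s hs x hx => by
    refine χ.one_of_mem_closedBall ?_
    rw [mem_closedBall_zero_iff, Prod.norm_def]
    refine max_le ?_ hx
    rw [Real.norm_eq_abs, abs_of_nonneg hs.1]
    change s ≤ |R| + 1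
    linarith [hs.2]
  have hχ0 : ∀ s x, |R| + 2 < ‖x‖ → χ (s, x) = 0 := fun s x hx => by
    refine χ.zero_of_le_dist ?_
    rw [dist_zero_right]
    exact hx.le.trans (norm_snd_le (s, x))
  obtain ⟨C, hC⟩ := (χ.contDiff.smul hX).lipschitzWith_of_hasCompactSupport
    (χ.hasCompactSupport.smul_right (f' := X)) one_ne_zero
  have hlip : ∀ s, LipschitzWith C fun x => χ (s, x) • X (s, x) := fun s =>
    LipschitzWith.of_dist_le_mul fun x x' =>
      (hC.dist_le_mul (s, x) (s, x')).trans_eq (by simp [Prod.dist_eq])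
  obtain ⟨δ, hδ, hδb⟩ : ∃ δ > 0, gronwallBound 0 C (0 + δ) 1 < min ε 1 := by
    have h := (gronwallBound_continuous_ε 0 C 1).tendsto 0
    rw [gronwallBound_ε0_δ0] at h
    have h2 := (h.eventually (gt_mem_nhds (lt_min hε one_pos)))
    obtain ⟨δ, h3, h4⟩ := ((h2.filter_mono nhdsWithin_le_nhds).and
      (self_mem_nhdsWithin (s := Ioi (0 : ℝ)))).exists
    exact ⟨δ, h4, by simpa using h3⟩
  refine ⟨δ, hδ, fun Y hY hYX z hz hzR => ?_⟩
  obtain ⟨y, hy0, hy⟩ := exists_hasDerivWithinAt_of_continuous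
    (F := fun p => χ p • Y p) (χ.continuous.smul hY)
    (χ.hasCompactSupport.smul_right (f' := Y)) (z 0)
  have key : ∀ s ∈ Icc (0 : ℝ) 1, ‖y s - z s‖ ≤ min ε 1 := by
    intro s hs
    have hright : ∀ {w w' : ℝ → E}, (∀ s ∈ Icc (0 : ℝ) 1, HasDerivWithinAt w (w' s) (Icc 0 1) s) →
        ∀ s ∈ Ico (0 : ℝ) 1, HasDerivWithinAt w (w' s) (Ici s) s := fun h s hs =>
      ((h s (Ico_subset_Icc_self hs)).mono_of_mem_nhdsWithin
        (Icc_mem_nhdsGE_of_mem hs))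
    have h := dist_le_of_approx_trajectories_ODE (v := fun s x => χ (s, x) • X (s, x)) (εf := 0)
      (εg := δ) (δ := 0) (a := 0) (b := 1) hlip
      (f := z) (f' := fun s => X (s, z s)) (fun s hs => (hz s hs).continuousWithinAt)
      (hright hz) (fun s hs => ?_) (g := y) (g' := fun s => χ (s, y s) • Y (s, y s))
      (fun s hs => (hy s hs).continuousWithinAt) (hright hy) (fun s hs => ?_) (by simp [hy0]) s hs
    · rw [dist_comm, dist_eq_norm] at h
      refine h.trans (le_trans ?_ hδb.le)
      refine gronwallBound_mono le_rfl (by linarith) C.2 ?_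
      linarith [hs.2]
    · have hs' := Ico_subset_Icc_self hs
      rw [hχ1 s hs' _ ((hzR s hs').trans ((le_abs_self R).trans (by linarith)))]
      simp
    · have hs' := Ico_subset_Icc_self hs
      rw [dist_eq_norm, ← smul_sub, norm_smul, Real.norm_of_nonneg χ.nonneg]
      rcases le_or_gt ‖y s‖ (|R| + 2) with h | h
      · calc _ ≤ 1 * δ := by
              gcongr
              · exact χ.le_one
              · exact hYX s hs' _ h
          _ = δ := one_mul δ
      · rw [hχ0 s _ h, zero_mul]
        exact hδ.le
  refine ⟨y, hy0, fun s hs => ?_, fun s hs => (key s hs).trans (min_le_left _ _)⟩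
  have h := hy s hs
  rwa [hχ1 s hs _ ?_, one_smul] at h
  have h1 := (key s hs).trans (min_le_right _ _)
  linarith [norm_le_norm_add_norm_sub' (y s) (z s), hzR s hs, le_abs_self R]
end ODE

section Reach

variable {d : ℕ}

/-- Finite sums of smooth time-dependent ridge gradients vanishing outside `(0, 1)`. -/
def ridgeFields (d : ℕ) : Submodule ℝ (ℝ → Vec d → Vec d) :=
  Submodule.span ℝ {G | ∃ (θ f : ℝ → ℝ) (α : Vec d), ContDiff ℝ ∞ θ ∧ ContDiff ℝ ∞ f ∧
    (∀ s, s ≤ 0 ∨ 1 ≤ s → θ s = 0) ∧ G = fun s y => (θ s * f (inner ℝ α y)) • α}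

theorem mem_ridgeFields {θ f : ℝ → ℝ} (hθ : ContDiff ℝ ∞ θ) (hf : ContDiff ℝ ∞ f)
    (hθ0 : ∀ s, s ≤ 0 ∨ 1 ≤ s → θ s = 0) (α : Vec d) :
    (fun s y => (θ s * f (inner ℝ α y)) • α) ∈ ridgeFields d :=
  Submodule.subset_span ⟨θ, f, α, hθ, hf, hθ0, rfl⟩

theorem ridgeFields_eq_zero {G : ℝ → Vec d → Vec d} (hG : G ∈ ridgeFields d) {s : ℝ}
    (hs : s ≤ 0 ∨ 1 ≤ s) (y : Vec d) : G s y = 0 := by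
  induction hG using Submodule.span_induction with
  | mem G hG => obtain ⟨θ, f, α, -, -, h, rfl⟩ := hG; simp [h s hs]
  | zero => rfl
  | add G G' _ _ h h' => simp [h, h']
  | smul c G _ h => simp [h]

theorem contDiff_of_mem_ridgeFields {G : ℝ → Vec d → Vec d} (hG : G ∈ ridgeFields d) :
    ContDiff ℝ 1 fun p : ℝ × Vec d => G p.1 p.2 := by
  induction hG using Submodule.span_induction with
  | mem G hG =>
    obtain ⟨θ, f, α, hθ, hf, -, rfl⟩ := hG
    suffices h : ContDiff ℝ 1 fun p : ℝ × Vec d => θ p.1 * f (inner ℝ α p.2) from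
      h.smul contDiff_const
    refine ContDiff.mul ?_ ?_
    · exact (hθ.of_le (by exact_mod_cast le_top)).comp contDiff_fst
    · exact (hf.of_le (by exact_mod_cast le_top)).comp
        ((contDiff_const (c := α)).inner ℝ contDiff_snd)
  | zero => exact contDiff_const
  | add G G' _ _ h h' => exact h.add h'
  | smul c G _ h => exact h.const_smul c

theorem rescale_mem_ridgeFields {G : ℝ → Vec d → Vec d} (hG : G ∈ ridgeFields d) (m r : ℝ)
    (hr : ∀ s, s ≤ 0 ∨ 1 ≤ s → m * s + r ≤ 0 ∨ 1 ≤ m * s + r) :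
    (fun s y => m • G (m * s + r) y) ∈ ridgeFields d := by
  induction hG using Submodule.span_induction with
  | mem G hG =>
    obtain ⟨θ, f, α, hθ, hf, h, rfl⟩ := hG
    convert! mem_ridgeFields (θ := fun s => m * θ (m * s + r)) (f := f) ?_ hf ?_ α using 3 with s y
    · rw [smul_smul, mul_assoc]
    · exact contDiff_const.mul (hθ.comp ((contDiff_const.mul contDiff_id).add contDiff_const))
    · intro s hs; rw [h _ (hr s hs), mul_zero]
  | zero => convert Submodule.zero_mem _; simp
  | add G G' _ _ h h' =>
    convert Submodule.add_mem _ h h' using 3 with s y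
    simp
  | smul c G _ h =>
    convert Submodule.smul_mem _ c h using 3 with s y
    exact smul_comm m c _

/-- `g` is the time-`1` map of a separable Hamiltonian flow generated by smooth ridge fields. -/
def Reachable (g : Phase d → Phase d) : Prop :=
  ∃ Gp ∈ ridgeFields d, ∃ Gq ∈ ridgeFields d, ∃ ψ : ℝ → Phase d → Phase d,
    (∀ s ≤ 0, ∀ x, ψ s x = x) ∧ (∀ s ≥ 1, ∀ x, ψ s x = g x) ∧
    (∀ s x, HasDerivAt (fun u => ψ u x) (Gp s (ψ s x).2, -Gq s (ψ s x).1) s) ∧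
    Continuous fun p : ℝ × Phase d => ψ p.1 p.2

theorem Reachable.id : Reachable (fun x : Phase d => x) :=
  ⟨0, Submodule.zero_mem _, 0, Submodule.zero_mem _, fun _ x => x, fun _ _ _ => rfl,
    fun _ _ _ => rfl, fun s x => by simpa using! hasDerivAt_const s x, continuous_snd⟩

theorem Reachable.comp {g₁ g₂ : Phase d → Phase d} (h₂ : Reachable g₂) (h₁ : Reachable g₁) :
    Reachable fun x => g₂ (g₁ x) := by
  obtain ⟨P₁, hP₁, Q₁, hQ₁, ψ₁, h0₁, h1₁, hd₁, hc₁⟩ := h₁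
  obtain ⟨P₂, hP₂, Q₂, hQ₂, ψ₂, h0₂, h1₂, hd₂, hc₂⟩ := h₂
  have hr₁ : ∀ s : ℝ, s ≤ 0 ∨ 1 ≤ s → 2 * s + 0 ≤ 0 ∨ 1 ≤ 2 * s + 0 := fun s hs =>
    hs.imp (fun h => by linarith) (fun h => by linarith)
  have hr₂ : ∀ s : ℝ, s ≤ 0 ∨ 1 ≤ s → 2 * s + -1 ≤ 0 ∨ 1 ≤ 2 * s + -1 := fun s hs =>
    hs.imp (fun h => by linarith) (fun h => by linarith)
  refine ⟨_, Submodule.add_mem _ (rescale_mem_ridgeFields hP₁ 2 0 hr₁)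
    (rescale_mem_ridgeFields hP₂ 2 (-1) hr₂), _,
    Submodule.add_mem _ (rescale_mem_ridgeFields hQ₁ 2 0 hr₁)
    (rescale_mem_ridgeFields hQ₂ 2 (-1) hr₂),
    fun s x => ψ₂ (2 * s + -1) (ψ₁ (2 * s + 0) x), ?_, ?_, ?_, ?_⟩
  · intro s hs x
    beta_reduce
    rw [h0₂ _ (by linarith), h0₁ _ (by linarith)]
  · intro s hs x
    beta_reduce
    rw [h1₂ _ (by linarith), h1₁ _ (by linarith)]
  · intro s x
    have hlin : ∀ r : ℝ, HasDerivAt (fun u : ℝ => 2 * u + r) 2 s := fun r => by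
      simpa using ((hasDerivAt_id s).const_mul 2).add_const r
    have hL : s ≤ 1 / 2 → HasDerivWithinAt (fun u => ψ₂ (2 * u + -1) (ψ₁ (2 * u + 0) x))
        ((((fun s y => (2 : ℝ) • P₁ (2 * s + 0) y) + fun s y => (2 : ℝ) • P₂ (2 * s + -1) y) s
          (ψ₂ (2 * s + -1) (ψ₁ (2 * s + 0) x)).2,
        -((fun s y => (2 : ℝ) • Q₁ (2 * s + 0) y) + fun s y => (2 : ℝ) • Q₂ (2 * s + -1) y) s
          (ψ₂ (2 * s + -1) (ψ₁ (2 * s + 0) x)).1)) (Iic (1 / 2)) s := by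
      intro hs
      have h := ((hd₁ (2 * s + 0) x).scomp s (hlin 0)).hasDerivWithinAt (s := Iic (1 / 2))
      have h' := h.congr_of_mem (f₁ := fun u => ψ₂ (2 * u + -1) (ψ₁ (2 * u + 0) x))
        (fun u hu => h0₂ _ (by linarith [mem_Iic.1 hu]) _) hs
      convert! h' using 1
      have h1 : 2 * s + -1 ≤ 0 := by linarith
      simp [ridgeFields_eq_zero hP₂ (Or.inl h1), ridgeFields_eq_zero hQ₂ (Or.inl h1), h0₂ _ h1]
    have hR : 1 / 2 ≤ s → HasDerivWithinAt (fun u => ψ₂ (2 * u + -1) (ψ₁ (2 * u + 0) x))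
        ((((fun s y => (2 : ℝ) • P₁ (2 * s + 0) y) + fun s y => (2 : ℝ) • P₂ (2 * s + -1) y) s
          (ψ₂ (2 * s + -1) (ψ₁ (2 * s + 0) x)).2,
        -((fun s y => (2 : ℝ) • Q₁ (2 * s + 0) y) + fun s y => (2 : ℝ) • Q₂ (2 * s + -1) y) s
          (ψ₂ (2 * s + -1) (ψ₁ (2 * s + 0) x)).1)) (Ici (1 / 2)) s := by
      intro hs
      have h := ((hd₂ (2 * s + -1) (g₁ x)).scomp s (hlin (-1))).hasDerivWithinAt
        (s := Ici (1 / 2))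
      have h' := h.congr_of_mem (f₁ := fun u => ψ₂ (2 * u + -1) (ψ₁ (2 * u + 0) x))
        (fun u hu => by
          change ψ₂ _ _ = ψ₂ _ _
          rw [h1₁ _ (by linarith [mem_Ici.1 hu])]) hs
      convert! h' using 1
      have h1 : 1 ≤ 2 * s + 0 := by linarith
      have h2 := h1₁ _ h1 x
      simp only [add_zero] at h1 h2
      simp [ridgeFields_eq_zero hP₁ (Or.inr h1), ridgeFields_eq_zero hQ₁ (Or.inr h1), h2]
    rcases lt_trichotomy s (1 / 2) with hs | hs | hs
    · exact (hL hs.le).hasDerivAt (Iic_mem_nhds hs)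
    · have := (hL hs.le).union (hR hs.ge)
      rwa [Iic_union_Ici, hasDerivWithinAt_univ] at this
    · exact (hR hs.le).hasDerivAt (Ici_mem_nhds hs)
  · have h := hc₁.comp (by fun_prop : Continuous fun p : ℝ × Phase d => (2 * p.1 + 0, p.2))
    exact hc₂.comp ((by fun_prop : Continuous fun p : ℝ × Phase d => 2 * p.1 + -1).prodMk h)

theorem deriv_smoothTransition_eq_zero (s : ℝ) (hs : s ≤ 0 ∨ 1 ≤ s) :
    deriv Real.smoothTransition s = 0 := by
  rcases hs with hs | hs
  · refine IsLocalMin.deriv_eq_zero (.of_forall fun t => ?_)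
    rw [Real.smoothTransition.zero_of_nonpos hs]
    exact Real.smoothTransition.nonneg t
  · refine IsLocalMax.deriv_eq_zero (.of_forall fun t => ?_)
    rw [Real.smoothTransition.one_of_one_le hs]
    exact Real.smoothTransition.le_one t

theorem contDiff_deriv_smoothTransition : ContDiff ℝ ∞ (deriv Real.smoothTransition) :=
  (contDiff_infty_iff_deriv.1 Real.smoothTransition.contDiff).2

theorem hasDerivAt_smoothTransition (s : ℝ) :
    HasDerivAt Real.smoothTransition (deriv Real.smoothTransition s) s :=
  ((Real.smoothTransition.contDiff (n := 1)).differentiable one_ne_zero s).hasDerivAt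

theorem reachable_shear_snd {f : ℝ → ℝ} (hf : ContDiff ℝ ∞ f) (α : Vec d) :
    Reachable fun x : Phase d => (x.1, x.2 - f (inner ℝ α x.1) • α) := by
  have hΘ := Real.smoothTransition.continuous
  have hfc := hf.continuous
  refine ⟨0, Submodule.zero_mem _, _, mem_ridgeFields contDiff_deriv_smoothTransition hf
    deriv_smoothTransition_eq_zero α,
    fun s x => (x.1, x.2 - (Real.smoothTransition s * f (inner ℝ α x.1)) • α), ?_, ?_, ?_, ?_⟩
  · intro s hs x; simp [Real.smoothTransition.zero_of_nonpos hs]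
  · intro s hs x; simp [Real.smoothTransition.one_of_one_le hs]
  · intro s x
    refine HasDerivAt.prodMk (hasDerivAt_const _ _) ?_
    exact (((hasDerivAt_smoothTransition s).mul_const _).smul_const α).const_sub _
  · fun_prop

theorem reachable_shear_fst {f : ℝ → ℝ} (hf : ContDiff ℝ ∞ f) (α : Vec d) :
    Reachable fun x : Phase d => (x.1 + f (inner ℝ α x.2) • α, x.2) := by
  have hΘ := Real.smoothTransition.continuous
  have hfc := hf.continuous
  refine ⟨_, mem_ridgeFields contDiff_deriv_smoothTransition hf
    deriv_smoothTransition_eq_zero α, 0, Submodule.zero_mem _,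
    fun s x => (x.1 + (Real.smoothTransition s * f (inner ℝ α x.2)) • α, x.2), ?_, ?_, ?_, ?_⟩
  · intro s hs x; simp [Real.smoothTransition.zero_of_nonpos hs]
  · intro s hs x; simp [Real.smoothTransition.one_of_one_le hs]
  · intro s x
    refine HasDerivAt.prodMk ?_ (by simpa using! hasDerivAt_const s x.2)
    exact (((hasDerivAt_smoothTransition s).mul_const _).smul_const α).const_add _
  · fun_prop

/-- The exact time-one flow of the ridge Hamiltonian with profile a primitive of `f`. -/
def ridgeMap (f : ℝ → ℝ) (α β : Vec d) (x : Phase d) : Phase d :=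
  x + f (inner ℝ α x.1 + inner ℝ β x.2) • (β, -α)

theorem reachable_ridgeMap_conj {f : ℝ → ℝ} {α β : Vec d} (h : Reachable (ridgeMap f α β))
    (γ : Vec d) (c : ℝ) : Reachable (ridgeMap f α (β + (c * inner ℝ α γ) • γ)) := by
  have hL : ∀ c : ℝ, Reachable fun x : Phase d => (x.1 + (c * inner ℝ γ x.2) • γ, x.2) :=
    fun c => reachable_shear_fst (f := fun t => c * t) (contDiff_const.mul contDiff_id) γ
  convert (hL (-c)).comp (h.comp (hL c)) using 2 with x
  have e : inner ℝ α (x.1 + (c * inner ℝ γ x.2) • γ) + inner ℝ β x.2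
      = inner ℝ α x.1 + inner ℝ (β + (c * inner ℝ α γ) • γ) x.2 := by
    simp only [inner_add_right, inner_add_left, inner_smul_left, inner_smul_right,
      RCLike.conj_to_real]
    ring
  simp only [ridgeMap, e]
  generalize f _ = r
  ext1
  · simp only [Prod.fst_add, Prod.snd_add, Prod.smul_fst, Prod.smul_snd, inner_add_right,
      inner_smul_right, inner_neg_right, real_inner_comm α γ]
    module
  · simp

theorem reachable_ridgeMap {f : ℝ → ℝ} (hf : ContDiff ℝ ∞ f) (α β : Vec d) :
    Reachable (ridgeMap f α β) := by
  rcases eq_or_ne α 0 with rfl | hα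
  · convert! reachable_shear_fst hf β using 2 with x
    simp [ridgeMap, Prod.ext_iff]
  · have h0 : Reachable (ridgeMap f α 0) := by
      convert! reachable_shear_snd hf α using 2 with x
      simp [ridgeMap, Prod.ext_iff, sub_eq_add_neg]
    have hαα : inner ℝ α α ≠ 0 := inner_self_ne_zero.2 hα
    let c : ℝ := (inner ℝ α β - 1) / inner ℝ α α
    have h1 := reachable_ridgeMap_conj h0 α (c / inner ℝ α α)
    have h2 := reachable_ridgeMap_conj h1 (β - c • α) 1
    have e : inner ℝ α (β - c • α) = 1 := by
      rw [inner_sub_right, inner_smul_right, div_mul_cancel₀ _ hαα]; ring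
    rw [div_mul_cancel₀ _ hαα, e] at h2
    convert h2 using 2
    module

end Reach

section Splitting

variable {d : ℕ}

/-- Time-dependent vector fields whose flow has a consistent one-step method made of reachable
maps. -/
structure Steppable (a b : ℝ) (f : ℝ → Phase d → Phase d) : Prop where
  continuous : Continuous fun p : ℝ × Phase d => f p.1 p.2
  lipschitz : ∀ R : ℝ, ∃ L : NNReal, ∀ t ∈ Icc a b,
    LipschitzOnWith L (f t) (Metric.closedBall 0 R)
  step : ∀ R : ℝ, ∀ η > 0, ∃ h₀ > 0, ∀ h, 0 < h → h ≤ h₀ → ∀ t ∈ Icc a b,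
    ∃ Ψ, Reachable Ψ ∧ ∀ x, ‖x‖ ≤ R → ‖Ψ x - x - h • f t x‖ ≤ η * h

theorem exists_bound_on_Icc_prod {f : ℝ → Phase d → Phase d}
    (hf : Continuous fun p : ℝ × Phase d => f p.1 p.2) (a b : ℝ) {K : Set (Phase d)}
    (hK : IsCompact K) : ∃ M > 0, ∀ t ∈ Icc a b, ∀ x ∈ K, ‖f t x‖ ≤ M := by
  obtain ⟨M, hM⟩ := ((isCompact_Icc (a := a) (b := b)).prod hK).exists_bound_of_continuousOn
    hf.continuousOn
  exact ⟨max M 1, by positivity, fun t ht x hx => (hM (t, x) ⟨ht, hx⟩).trans (le_max_left _ _)⟩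

theorem Steppable.zero (a b : ℝ) : Steppable a b (fun _ (_ : Phase d) => 0) where
  continuous := continuous_const
  lipschitz _ := ⟨0, fun _ _ => (LipschitzWith.const _).lipschitzOnWith⟩
  step R η hη := ⟨1, one_pos, fun h hh _ _ _ => ⟨_, Reachable.id, fun x _ => by
    simp only [sub_self, smul_zero, norm_zero]; positivity⟩⟩

theorem Steppable.add {a b : ℝ} {f₁ f₂ : ℝ → Phase d → Phase d} (h₁ : Steppable a b f₁)
    (h₂ : Steppable a b f₂) : Steppable a b fun t x => f₁ t x + f₂ t x where
  continuous := h₁.continuous.add h₂.continuous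
  lipschitz R := by
    obtain ⟨L₁, hL₁⟩ := h₁.lipschitz R
    obtain ⟨L₂, hL₂⟩ := h₂.lipschitz R
    exact ⟨L₁ + L₂, fun t ht => (hL₁ t ht).add (hL₂ t ht)⟩
  step R η hη := by
    obtain ⟨M, hM, hfM⟩ := exists_bound_on_Icc_prod h₁.continuous a b
      (isCompact_closedBall (0 : Phase d) R)
    obtain ⟨L, hL⟩ := h₂.lipschitz (R + 1)
    obtain ⟨k₁, hk₁, hs₁⟩ := h₁.step R (min (η / 3) 1) (by positivity)
    obtain ⟨k₂, hk₂, hs₂⟩ := h₂.step (R + 1) (η / 3) (by positivity)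
    have hL0 : 0 ≤ (L : ℝ) := L.2
    refine ⟨min (min k₁ k₂) (min (1 / (M + 1)) (η / 3 / ((L + 1) * (M + 1)))), by positivity,
      fun h hh hle t ht => ?_⟩
    obtain ⟨⟨hle₁, hle₂⟩, hle₃, hle₄⟩ := by simpa only [le_min_iff] using hle
    rw [le_div_iff₀ (by positivity)] at hle₃ hle₄
    obtain ⟨Ψ₁, hR₁, hΨ₁⟩ := hs₁ h hh hle₁ t ht
    obtain ⟨Ψ₂, hR₂, hΨ₂⟩ := hs₂ h hh hle₂ t ht
    refine ⟨_, hR₂.comp hR₁, fun x hx => ?_⟩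
    have hx' : x ∈ Metric.closedBall (0 : Phase d) R := by simpa using hx
    have e1 := hΨ₁ x hx
    have hm1 : min (η / 3) 1 * h ≤ η / 3 * h := by gcongr; exact min_le_left _ _
    have hm2 : min (η / 3) 1 * h ≤ 1 * h := by gcongr; exact min_le_right _ _
    have e2 : ‖Ψ₁ x - x‖ ≤ h * (M + 1) := by
      have h3 : ‖h • f₁ t x‖ ≤ h * M := by
        rw [norm_smul, Real.norm_of_nonneg hh.le]
        exact mul_le_mul_of_nonneg_left (hfM t ht x hx') hh.le
      linarith [norm_le_norm_add_norm_sub' (Ψ₁ x - x) (h • f₁ t x)]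
    have hy : ‖Ψ₁ x‖ ≤ R + 1 := by
      linarith [norm_le_norm_add_norm_sub' (Ψ₁ x) x]
    have e3 := hΨ₂ _ hy
    have e4 : ‖h • (f₂ t (Ψ₁ x) - f₂ t x)‖ ≤ η / 3 * h := by
      rw [norm_smul, Real.norm_of_nonneg hh.le]
      have := (hL t ht).dist_le_mul (Ψ₁ x) (by simpa using hy) x
        (Metric.closedBall_subset_closedBall (by linarith) hx')
      rw [dist_eq_norm, dist_eq_norm] at this
      have h5 : (L : ℝ) * ‖Ψ₁ x - x‖ ≤ (L + 1) * (h * (M + 1)) := by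
        gcongr; linarith
      nlinarith
    have e : Ψ₂ (Ψ₁ x) - x - h • (f₁ t x + f₂ t x) = (Ψ₂ (Ψ₁ x) - Ψ₁ x - h • f₂ t (Ψ₁ x))
        + (Ψ₁ x - x - h • f₁ t x) + h • (f₂ t (Ψ₁ x) - f₂ t x) := by
      module
    rw [e]
    linarith [norm_add₃_le (a := Ψ₂ (Ψ₁ x) - Ψ₁ x - h • f₂ t (Ψ₁ x))
      (b := Ψ₁ x - x - h • f₁ t x) (c := h • (f₂ t (Ψ₁ x) - f₂ t x))]

theorem steppable_ridge (a b : ℝ) {c g : ℝ → ℝ} (hc : Continuous c) (hg : ContDiff ℝ ∞ g)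
    (α β : Vec d) : Steppable a b fun t x =>
      c t • (g (inner ℝ α x.1 + inner ℝ β x.2) • (β, -α)) where
  continuous := by
    have := hg.continuous
    fun_prop
  lipschitz R := by
    have h1 : ContDiff ℝ 1 fun x : Phase d =>
        g (inner ℝ α x.1 + inner ℝ β x.2) • ((β, -α) : Phase d) := by
      have : ContDiff ℝ 1 fun x : Phase d => inner ℝ α x.1 + inner ℝ β x.2 :=
        ((contDiff_const (c := α)).inner ℝ contDiff_fst).add
          ((contDiff_const (c := β)).inner ℝ contDiff_snd)
      exact ((hg.of_le (by exact_mod_cast le_top)).comp this).smul contDiff_const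
    obtain ⟨L, hL⟩ := h1.locallyLipschitz.locallyLipschitzOn.exists_lipschitzOnWith_of_compact
      (isCompact_closedBall (0 : Phase d) R)
    obtain ⟨C, hC⟩ := (isCompact_Icc (a := a) (b := b)).exists_bound_of_continuousOn
      hc.continuousOn
    refine ⟨‖C‖₊ * L, fun t ht => LipschitzOnWith.of_dist_le_mul fun x hx y hy => ?_⟩
    rw [dist_smul₀, NNReal.coe_mul, mul_assoc]
    refine mul_le_mul ?_ (hL.dist_le_mul x hx y hy) dist_nonneg (norm_nonneg _)
    exact (hC t ht).trans (le_abs_self C)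
  step R η hη := by
    refine ⟨1, one_pos, fun h hh _ t _ => ⟨_, reachable_ridgeMap
      (f := fun r => h * c t * g r) (contDiff_const.mul hg) α β, fun x _ => ?_⟩⟩
    have : ridgeMap (fun r => h * c t * g r) α β x - x -
        h • c t • (g (inner ℝ α x.1 + inner ℝ β x.2) • ((β, -α) : Phase d)) = 0 := by
      simp only [ridgeMap]
      module
    rw [this, norm_zero]
    positivity

/-- Compositions of reachable one-step maps converge to the flow of a steppable field. -/
theorem Steppable.exists_reachable_near {a b : ℝ} (hab : a < b) {f : ℝ → Phase d → Phase d}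
    (hf : Steppable a b f) {Ω K : Set (Phase d)} (hK : IsCompact K) {z : Phase d → ℝ → Phase d}
    (hza : ∀ x ∈ Ω, z x a = x)
    (hz : ∀ x ∈ Ω, ∀ s ∈ Icc a b, HasDerivWithinAt (z x) (f s (z x s)) (Icc a b) s)
    (hzK : ∀ x ∈ Ω, ∀ s ∈ Icc a b, z x s ∈ K) {ε : ℝ} (hε : 0 < ε) :
    ∃ g, Reachable g ∧ ∀ x ∈ Ω, ‖g x - z x b‖ ≤ ε := by
  obtain ⟨R, hR⟩ := hK.isBounded.subset_closedBall 0
  have hKR : ∀ x ∈ K, ‖x‖ ≤ R := fun x hx => by simpa using hR hx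
  obtain ⟨L, hL⟩ := hf.lipschitz (R + 1)
  have hL0 : 0 ≤ (L : ℝ) := L.2
  obtain ⟨M, hM, hfM⟩ := exists_bound_on_Icc_prod hf.continuous a b hK
  have hT : 0 < b - a := sub_pos.2 hab
  obtain ⟨η, hη, hηb⟩ : ∃ η > 0, 2 * η * (b - a) * Real.exp (L * (b - a)) = min ε 1 :=
    ⟨min ε 1 / (2 * (b - a) * Real.exp (L * (b - a))), by positivity, by field_simp⟩
  obtain ⟨δ, hδ, hunif⟩ := Metric.uniformContinuousOn_iff.1
    (((isCompact_Icc (a := a) (b := b)).prod hK).uniformContinuousOn_of_continuous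
      hf.continuous.continuousOn) η hη
  obtain ⟨h₀, hh₀, hstep⟩ := hf.step (R + 1) η hη
  obtain ⟨N, hN⟩ := exists_nat_gt ((b - a) / min h₀ (min δ (δ / M)))
  have hN0 : (0 : ℝ) < N := lt_of_le_of_lt (by positivity) hN
  obtain ⟨h, hh⟩ : ∃ h : ℝ, h = (b - a) / N := ⟨_, rfl⟩
  have hhpos : 0 < h := by rw [hh]; positivity
  have hNh : N * h = b - a := by rw [hh]; field_simp
  have hlt : h < min h₀ (min δ (δ / M)) := by
    rw [hh]; rwa [div_lt_comm₀ (by positivity) hN0] at hN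
  obtain ⟨hlt₁, hlt₂, hlt₃⟩ := by simpa only [lt_min_iff] using hlt
  rw [lt_div_iff₀ hM] at hlt₃
  have hcons : ∀ x ∈ Ω, ∀ t ∈ Icc a b, t + h ∈ Icc a b →
      ‖z x (t + h) - z x t - h • f t (z x t)‖ ≤ η * h := by
    intro x hx t ht hth
    have hsub : Icc t (t + h) ⊆ Icc a b := Icc_subset_Icc ht.1 hth.2
    have htm : t ∈ Icc t (t + h) := ⟨le_rfl, by linarith⟩
    have hthm : t + h ∈ Icc t (t + h) := ⟨by linarith, le_rfl⟩
    have hzl : ∀ s ∈ Icc t (t + h), ‖z x s - z x t‖ ≤ M * ‖s - t‖ := fun s hs =>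
      (convex_Icc t (t + h)).norm_image_sub_le_of_norm_hasDerivWithin_le
        (fun u hu => (hz x hx u (hsub hu)).mono hsub)
        (fun u hu => hfM u (hsub hu) _ (hzK x hx u (hsub hu))) htm hs
    have := (convex_Icc t (t + h)).norm_image_sub_le_of_norm_hasDerivWithin_le (C := η)
      (f := fun s => z x s - (s - t) • f t (z x t)) (f' := fun s => f s (z x s) - f t (z x t))
      (fun u hu => by
        have h1 := ((hz x hx u (hsub hu)).mono hsub).sub
          ((((hasDerivAt_id u).sub_const t).smul_const (f t (z x t))).hasDerivWithinAt
            (s := Icc t (t + h)))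
        simpa using! h1)
      (fun u hu => by
        rw [← dist_eq_norm]
        have hut : |u - t| ≤ h := abs_le.2 ⟨by linarith [hu.1], by linarith [hu.2]⟩
        refine (hunif (u, z x u) ⟨hsub hu, hzK x hx u (hsub hu)⟩ (t, z x t)
          ⟨ht, hzK x hx t ht⟩ ?_).le
        rw [Prod.dist_eq, max_lt_iff]
        constructor
        · rw [Real.dist_eq]; exact hut.trans_lt hlt₂
        · rw [dist_eq_norm]
          refine (hzl u hu).trans_lt (lt_of_le_of_lt ?_ hlt₃)
          rw [mul_comm]
          exact mul_le_mul_of_nonneg_right hut hM.le) htm hthm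
    rw [add_sub_cancel_left, sub_self, zero_smul, sub_zero, Real.norm_of_nonneg hhpos.le] at this
    rwa [sub_right_comm]
  have key : ∀ k : ℕ, k ≤ N → ∃ Ψ, Reachable Ψ ∧ ∀ x ∈ Ω,
      ‖Ψ x - z x (a + k * h)‖ ≤ 2 * η * (k * h) * Real.exp (L * (k * h)) := by
    intro k
    induction k with
    | zero => exact fun _ => ⟨_, Reachable.id, fun x hx => by simp [hza x hx]⟩
    | succ k ih =>
      intro hk
      have hk1 : ((k : ℝ) + 1) * h ≤ b - a := by
        rw [← hNh]
        gcongr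
        exact_mod_cast hk
      have hkh : 0 ≤ (k : ℝ) * h := by positivity
      have ht : a + k * h ∈ Icc a b := ⟨by linarith, by linarith⟩
      have hth : a + k * h + h ∈ Icc a b := ⟨by linarith, by linarith⟩
      obtain ⟨Ψ, hΨ, hΨz⟩ := ih (by omega)
      obtain ⟨Ψ', hΨ', hs⟩ := hstep h hhpos hlt₁.le _ ht
      refine ⟨_, hΨ'.comp hΨ, fun x hx => ?_⟩
      set t := a + k * h with htdef
      have e : a + ((k + 1 : ℕ) : ℝ) * h = t + h := by rw [htdef]; push_cast; ring
      rw [e]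
      have hzt := hzK x hx t ht
      have hE := hΨz x hx
      have hE1 : ‖Ψ x - z x t‖ ≤ 1 := by
        refine hE.trans (le_trans ?_ (hηb.le.trans (min_le_right _ _)))
        have : (k : ℝ) * h ≤ b - a := by linarith
        gcongr
      have hΨR : ‖Ψ x‖ ≤ R + 1 := by
        linarith [norm_le_norm_add_norm_sub' (Ψ x) (z x t), hKR _ hzt]
      have e1 := hs _ hΨR
      have e2 := hcons x hx t ht hth
      have e3 : ‖h • (f t (Ψ x) - f t (z x t))‖ ≤ h * (L * ‖Ψ x - z x t‖) := by
        rw [norm_smul, Real.norm_of_nonneg hhpos.le]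
        have := (hL t ht).dist_le_mul (Ψ x) (by simpa using hΨR) (z x t)
          (by simpa using (hKR _ hzt).trans (by linarith))
        rw [dist_eq_norm, dist_eq_norm] at this
        gcongr
      have e4 : Ψ' (Ψ x) - z x (t + h) = (Ψ' (Ψ x) - Ψ x - h • f t (Ψ x)) +
          (Ψ x - z x t) + h • (f t (Ψ x) - f t (z x t)) -
          (z x (t + h) - z x t - h • f t (z x t)) := by module
      have e5 : ‖Ψ' (Ψ x) - z x (t + h)‖ ≤ 2 * η * h + (L * h + 1) * ‖Ψ x - z x t‖ := by
        rw [e4]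
        refine (norm_sub_le _ _).trans ?_
        linarith [norm_add₃_le (a := Ψ' (Ψ x) - Ψ x - h • f t (Ψ x))
          (b := Ψ x - z x t) (c := h • (f t (Ψ x) - f t (z x t)))]
      have e6 : (L * h + 1) * ‖Ψ x - z x t‖ ≤
          Real.exp (L * h) * (2 * η * (k * h) * Real.exp (L * (k * h))) := by
        gcongr
        exact Real.add_one_le_exp _
      have e7 : Real.exp (L * h) * Real.exp (L * (k * h)) =
          Real.exp (L * (((k + 1 : ℕ) : ℝ) * h)) := by
        rw [← Real.exp_add]; congr 1; push_cast; ring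
      have e8 : 1 ≤ Real.exp (L * (((k + 1 : ℕ) : ℝ) * h)) := Real.one_le_exp (by positivity)
      calc _ ≤ 2 * η * h * 1 + Real.exp (L * h) * (2 * η * (k * h) * Real.exp (L * (k * h))) := by
            linarith
        _ ≤ 2 * η * h * Real.exp (L * (((k + 1 : ℕ) : ℝ) * h)) +
            2 * η * (k * h) * Real.exp (L * (((k + 1 : ℕ) : ℝ) * h)) := by
            rw [← e7]
            gcongr ?_ + ?_
            · rw [e7]; gcongr
            · exact le_of_eq (by ring)
        _ = _ := by push_cast; ring
  obtain ⟨Ψ, hΨ, h⟩ := key N le_rfl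
  refine ⟨Ψ, hΨ, fun x hx => ?_⟩
  have := h x hx
  rw [hNh, add_sub_cancel, hηb] at this
  exact this.trans (min_le_left _ _)

end Splitting

section PolynomialHamiltonian

variable {d : ℕ}

/-- Linear functionals on phase space. -/
def linearForms (d : ℕ) : Submodule ℝ (Phase d → ℝ) where
  carrier := {w | ∃ α β : Vec d, w = fun x => inner ℝ α x.1 + inner ℝ β x.2}
  add_mem' := by
    rintro _ _ ⟨α, β, rfl⟩ ⟨α', β', rfl⟩
    refine ⟨α + α', β + β', ?_⟩
    ext x
    simp only [Pi.add_apply, inner_add_left]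
    ring
  zero_mem' := ⟨0, 0, by ext; simp⟩
  smul_mem' := by
    rintro c _ ⟨α, β, rfl⟩
    refine ⟨c • α, c • β, ?_⟩
    ext x
    simp [inner_smul_left, mul_add]

theorem eval_mem_powSpan (P : MvPolynomial (Fin d ⊕ Fin d) ℝ) :
    (fun x : Phase d => MvPolynomial.eval (Sum.elim (fun j => x.1 j) (fun j => x.2 j)) P) ∈
      powSpan (linearForms d) := by
  rw [← mem_powSpanSubalgebra]
  induction P using MvPolynomial.induction_on with
  | C r =>
    convert (powSpanSubalgebra (linearForms d)).algebraMap_mem r using 1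
    ext x
    simp
  | add P Q hP hQ =>
    convert (powSpanSubalgebra (linearForms d)).add_mem hP hQ using 1
    ext x
    simp
  | mul_X P i hP =>
    have hX : (fun x : Phase d => (Sum.elim (fun j => x.1 j) (fun j => x.2 j) : _ → ℝ) i) ∈
        powSpanSubalgebra (linearForms d) := by
      rw [mem_powSpanSubalgebra]
      have h : (fun x : Phase d => (Sum.elim (fun j => x.1 j) (fun j => x.2 j) : _ → ℝ) i) ∈
          linearForms d := by
        rcases i with j | j
        · exact ⟨EuclideanSpace.single j 1, 0, by ext; simp [EuclideanSpace.inner_single_left]⟩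
        · exact ⟨0, EuclideanSpace.single j 1, by ext; simp [EuclideanSpace.inner_single_left]⟩
      simpa using pow_mem_powSpan h 1
    convert (powSpanSubalgebra (linearForms d)).mul_mem hP hX using 1
    ext x
    simp

/-- `H` is partially differentiable in both variables with Hamiltonian field `F`. -/
def HasHamiltonianField (H : Phase d → ℝ) (F : Phase d → Phase d) : Prop :=
  ∀ x : Phase d, HasGradientAt (fun p => H (x.1, p)) (F x).1 x.2 ∧
    HasGradientAt (fun q => H (q, x.2)) (-(F x).2) x.1

theorem HasHamiltonianField.jgradH {H : Phase d → ℝ} {F : Phase d → Phase d}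
    (h : HasHamiltonianField H F) : JgradH H = F := by
  funext x
  simp only [JgradH, gradP, gradQ, (h x).1.gradient, (h x).2.gradient, neg_neg]

theorem HasHamiltonianField.zero : HasHamiltonianField (fun _ : Phase d => 0) fun _ => 0 :=
  fun _ => ⟨hasGradientAt_const _ _, by simpa using hasGradientAt_const _ _⟩

theorem HasHamiltonianField.add {H₁ H₂ : Phase d → ℝ} {F₁ F₂ : Phase d → Phase d}
    (h₁ : HasHamiltonianField H₁ F₁) (h₂ : HasHamiltonianField H₂ F₂) :
    HasHamiltonianField (fun x => H₁ x + H₂ x) fun x => F₁ x + F₂ x := fun x =>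
  ⟨(h₁ x).1.fun_add (h₂ x).1, by
    rw [Prod.snd_add, neg_add]; exact (h₁ x).2.fun_add (h₂ x).2⟩

theorem HasHamiltonianField.const_mul {H : Phase d → ℝ} {F : Phase d → Phase d}
    (h : HasHamiltonianField H F) (c : ℝ) :
    HasHamiltonianField (fun x => c * H x) fun x => c • F x := fun x =>
  ⟨(h x).1.fun_const_mul c, by
    rw [Prod.smul_snd, ← smul_neg]; exact (h x).2.fun_const_mul c⟩

theorem hasHamiltonianField_pow (α β : Vec d) (n : ℕ) :
    HasHamiltonianField (fun x : Phase d => (inner ℝ α x.1 + inner ℝ β x.2) ^ n)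
      fun x => (n * (inner ℝ α x.1 + inner ℝ β x.2) ^ (n - 1)) • (β, -α) := by
  intro x
  constructor
  · rw [hasGradientAt_iff_hasFDerivAt]
    have h := (((InnerProductSpace.toDual ℝ (Vec d) β).hasFDerivAt (x := x.2)).const_add
      (inner ℝ α x.1)).pow n
    convert! h using 1
    ext v
    simp
  · rw [hasGradientAt_iff_hasFDerivAt]
    have h := (((InnerProductSpace.toDual ℝ (Vec d) α).hasFDerivAt (x := x.1)).add_const
      (inner ℝ β x.2)).pow n
    convert! h using 1
    ext v
    simp

theorem steppable_of_mem_powSpan (a b : ℝ) {H : Phase d → ℝ} (hH : H ∈ powSpan (linearForms d)) :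
    ∃ F, HasHamiltonianField H F ∧
      ∀ c : ℝ → ℝ, Continuous c → Steppable a b fun t x => c t • F x := by
  induction hH using Submodule.span_induction with
  | mem H hH =>
    obtain ⟨_, ⟨α, β, rfl⟩, n, rfl⟩ := hH
    exact ⟨_, hasHamiltonianField_pow α β n, fun c hc =>
      steppable_ridge a b hc (g := fun r => n * r ^ (n - 1))
        (contDiff_const.mul (contDiff_id.pow _)) α β⟩
  | zero => exact ⟨_, .zero, fun c _ => by simpa using Steppable.zero a b⟩
  | add H H' _ _ h h' =>
    obtain ⟨F, hF, hs⟩ := h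
    obtain ⟨F', hF', hs'⟩ := h'
    exact ⟨_, hF.add hF', fun c hc => by simpa using (hs c hc).add (hs' c hc)⟩
  | smul r H _ h =>
    obtain ⟨F, hF, hs⟩ := h
    exact ⟨_, hF.const_mul r, fun c hc => by
      simpa [smul_smul] using hs (fun t => c t * r) (hc.mul continuous_const)⟩

/-- The Hamiltonian field of a polynomial Hamiltonian is steppable. -/
theorem IsPolyContCoeff.steppable {H : ℝ → Phase d → ℝ} (hH : IsPolyContCoeff H) (a b : ℝ) :
    Steppable a b fun t => JgradH (H t) := by
  obtain ⟨n, c, P, hc, hHP⟩ := hH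
  choose F hF hs using fun i => steppable_of_mem_powSpan a b (eval_mem_powSpan (P i))
  have key : ∀ s : Finset (Fin n),
      (∀ t, HasHamiltonianField (fun x : Phase d => ∑ i ∈ s, c i t * MvPolynomial.eval
        (Sum.elim (fun j => x.1 j) (fun j => x.2 j)) (P i)) fun x => ∑ i ∈ s, c i t • F i x) ∧
      Steppable a b fun t x => ∑ i ∈ s, c i t • F i x := by
    intro s
    induction s using Finset.induction_on with
    | empty => simpa using ⟨HasHamiltonianField.zero, Steppable.zero a b⟩
    | insert i s hi ih =>
      simp only [Finset.sum_insert hi]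
      exact ⟨fun t => ((hF i).const_mul (c i t)).add (ih.1 t), (hs i (c i) (hc i)).add ih.2⟩
  have e : (fun t => JgradH (H t)) = fun t x => ∑ i, c i t • F i x := by
    funext t
    rw [show H t = _ from funext (hHP t)]
    exact ((key Finset.univ).1 t).jgradH
  rw [e]
  exact (key Finset.univ).2

end PolynomialHamiltonian

section Final

variable {d : ℕ}

theorem exists_isShallowGradient_near {σ : ℝ → ℝ} (hσ : ContDiff ℝ 1 σ)
    (hσp : ¬ ∃ P : Polynomial ℝ, ∀ y : ℝ, σ y = P.eval y) {G : ℝ → Vec d → Vec d}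
    (hG : G ∈ ridgeFields d) (R : ℝ) {δ : ℝ} (hδ : 0 < δ) :
    ∃ V G', IsShallowGradient σ V G' ∧ ∀ s ∈ Icc (0 : ℝ) 1, ∀ y, ‖y‖ ≤ R →
      ‖G' s y - G s y‖ ≤ δ := by
  suffices h : ∀ c : ℝ, ∀ δ > 0, ∃ V G', IsShallowGradient σ V G' ∧ ∀ s ∈ Icc (0 : ℝ) 1, ∀ y,
      ‖y‖ ≤ R → ‖G' s y - c • G s y‖ ≤ δ by
    simpa using h 1 δ hδ
  induction hG using Submodule.span_induction with
  | mem G hG =>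
    obtain ⟨θ, f, α, hθ, hf, -, rfl⟩ := hG
    intro c δ hδ
    have := hθ.continuous
    have := hf.continuous
    simpa [mul_smul] using exists_isShallowGradient_near_ridge hσ hσp α
      (g := fun s r => c * (θ s * f r)) (by fun_prop) R hδ
  | zero => exact fun c δ hδ => ⟨_, _, .zero σ, fun s _ y _ => by simpa using hδ.le⟩
  | add G₁ G₂ _ _ h₁ h₂ =>
    intro c δ hδ
    obtain ⟨V₁, G₁', hV₁, hd₁⟩ := h₁ c (δ / 2) (half_pos hδ)
    obtain ⟨V₂, G₂', hV₂, hd₂⟩ := h₂ c (δ / 2) (half_pos hδ)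
    refine ⟨_, _, hV₁.add hV₂, fun s hs y hy => ?_⟩
    have e : G₁' s y + G₂' s y - c • (G₁ + G₂) s y =
        (G₁' s y - c • G₁ s y) + (G₂' s y - c • G₂ s y) := by
      simp only [Pi.add_apply]; module
    rw [e]
    linarith [norm_add_le (G₁' s y - c • G₁ s y) (G₂' s y - c • G₂ s y), hd₁ s hs y hy,
      hd₂ s hs y hy]
  | smul r G _ h =>
    intro c δ hδ
    simpa [smul_smul] using h (c * r) δ hδ

theorem supNorm_le_norm (x : Phase d) : supNorm x ≤ ‖x‖ := by
  have h : ∀ v : Vec d, ‖(WithLp.equiv 2 (Fin d → ℝ)) v‖ ≤ ‖v‖ := fun v =>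
    (pi_norm_le_iff_of_nonneg (norm_nonneg v)).2 fun i => PiLp.norm_apply_le v i
  exact max_le_max (h x.1) (h x.2)

theorem IsShallowGradient.jgradH {σ : ℝ → ℝ} {Vp Vq : ℝ → Vec d → ℝ} {Gp Gq : ℝ → Vec d → Vec d}
    (hp : IsShallowGradient σ Vp Gp) (hq : IsShallowGradient σ Vq Gq) (s : ℝ) :
    JgradH (fun y : Phase d => Vp s y.2 + Vq s y.1) = fun x => (Gp s x.2, -Gq s x.1) := by
  refine HasHamiltonianField.jgradH fun x => ⟨?_, ?_⟩
  · simpa using (hp.gradient s x.2).fun_add (hasGradientAt_const x.2 (Vq s x.1))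
  · simpa using (hasGradientAt_const x.1 (Vp s x.2)).fun_add (hq.gradient s x.1)

/-- Reachable maps are approximated on compact sets by separable shallow-network flows. -/
theorem Reachable.exists_shallow_flow_near {σ : ℝ → ℝ} (hσ : ContDiff ℝ 1 σ)
    (hσp : ¬ ∃ P : Polynomial ℝ, ∀ y : ℝ, σ y = P.eval y) {g : Phase d → Phase d}
    (hg : Reachable g) {Ω : Set (Phase d)} (hΩ : IsCompact Ω) {ε : ℝ} (hε : 0 < ε) :
    ∃ (Vq Vp : ℝ → Vec d → ℝ) (ψ : ℝ → Phase d → Phase d),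
      ShallowClass σ Vq ∧ ShallowClass σ Vp ∧
      (∀ x ∈ Ω, ψ 0 x = x) ∧
      (∀ x ∈ Ω, ∀ s ∈ Icc (0 : ℝ) 1,
        HasDerivWithinAt (fun u => ψ u x)
          (JgradH (fun y : Phase d => Vp s y.2 + Vq s y.1) (ψ s x)) (Icc 0 1) s) ∧
      (∀ x ∈ Ω, ‖ψ 1 x - g x‖ ≤ ε) := by
  obtain ⟨P, hP, Q, hQ, φ, h0, h1, hd, hc⟩ := hg
  obtain ⟨R, hR⟩ := ((isCompact_Icc (a := (0 : ℝ)) (b := 1)).prod hΩ).exists_bound_of_continuousOn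
    hc.continuousOn
  have hX : ContDiff ℝ 1 fun p : ℝ × Phase d => ((P p.1 p.2.2, -Q p.1 p.2.1) : Phase d) :=
    ((contDiff_of_mem_ridgeFields hP).comp
      (contDiff_fst.prodMk (contDiff_snd.comp contDiff_snd))).prodMk
    ((contDiff_of_mem_ridgeFields hQ).comp
      (contDiff_fst.prodMk (contDiff_fst.comp contDiff_snd))).neg
  obtain ⟨δ, hδ, hpert⟩ := exists_perturbed_solution hX R hε
  obtain ⟨Vp, Gp, hVp, hGp⟩ := exists_isShallowGradient_near hσ hσp hP (|R| + 2) hδ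
  obtain ⟨Vq, Gq, hVq, hGq⟩ := exists_isShallowGradient_near hσ hσp hQ (|R| + 2) hδ
  have hY : Continuous fun p : ℝ × Phase d => ((Gp p.1 p.2.2, -Gq p.1 p.2.1) : Phase d) :=
    (hVp.continuous.comp (by fun_prop : Continuous fun p : ℝ × Phase d => (p.1, p.2.2))).prodMk
      (hVq.continuous.comp (by fun_prop : Continuous fun p : ℝ × Phase d => (p.1, p.2.1))).neg
  have hclose : ∀ s ∈ Icc (0 : ℝ) 1, ∀ x : Phase d, ‖x‖ ≤ |R| + 2 →
      ‖((Gp s x.2, -Gq s x.1) : Phase d) - (P s x.2, -Q s x.1)‖ ≤ δ := by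
    intro s hs x hx
    rw [Prod.mk_sub_mk, Prod.norm_def]
    refine max_le (hGp s hs _ ((norm_snd_le x).trans hx)) ?_
    rw [← neg_sub', norm_neg]
    exact hGq s hs _ ((norm_fst_le x).trans hx)
  have hex : ∀ x : Phase d, ∃ y : ℝ → Phase d, x ∈ Ω → y 0 = x ∧
      (∀ s ∈ Icc (0 : ℝ) 1, HasDerivWithinAt y (Gp s (y s).2, -Gq s (y s).1) (Icc 0 1) s) ∧
      ‖y 1 - g x‖ ≤ ε := by
    intro x
    by_cases hx : x ∈ Ω
    · obtain ⟨y, hy0, hy, hyz⟩ := hpert _ hY hclose (fun s => φ s x)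
        (fun s _ => (hd s x).hasDerivWithinAt) fun s hs => hR (s, x) ⟨hs, hx⟩
      refine ⟨y, fun _ => ⟨by rw [hy0, h0 0 le_rfl], hy, ?_⟩⟩
      have := hyz 1 (by simp)
      rwa [h1 1 le_rfl] at this
    · exact ⟨0, fun h => absurd h hx⟩
  choose ψ hψ using hex
  refine ⟨Vq, Vp, fun s x => ψ x s, hVq.shallow, hVp.shallow, fun x hx => (hψ x hx).1,
    fun x hx s hs => ?_, fun x hx => (hψ x hx).2.2⟩
  rw [hVp.jgradH hVq]
  exact (hψ x hx).2.1 s hs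

end Final

end Development

/-- **Approximation of a flow by a separable shallow-network Hamiltonian flow.**
The flow map `Φ` of a polynomial (in `x`) Hamiltonian `H̃` over a subinterval `[a,b] ⊆ [0,Δt]`
can be approximated on the compact set `Ω`, to any accuracy `ε`, by the time-`1` flow (from
time `0`) of a separable Hamiltonian `H̄(s,(q,p)) = V̄_p(s,p) + V̄_q(s,q)` with `V̄_q, V̄_p` in
the shallow-network class built from the activation `σ`. -/
theorem separable_shallow_hamiltonian_flow_approximation
    (d : ℕ) (Ω : Set (Phase d)) (hΩ : IsCompact Ω)
    (σ : ℝ → ℝ) (hσ : ContDiff ℝ 1 σ)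
    (hσp : ¬ ∃ P : Polynomial ℝ, ∀ y : ℝ, σ y = P.eval y)
    (Δt a b : ℝ) (hab : a < b)
    (hsub : Set.Icc a b ⊆ Set.Icc (0:ℝ) Δt)
    (Ht : ℝ → Phase d → ℝ) (hHt : IsPolyContCoeff Ht)
    (z : Phase d → ℝ → Phase d)
    (hza : ∀ x ∈ Ω, z x a = x)
    (hz : ∀ x ∈ Ω, ∀ s ∈ Set.Icc a b,
      HasDerivWithinAt (z x) (JgradH (Ht s) (z x s)) (Set.Icc a b) s)
    (K : Set (Phase d)) (hK : IsCompact K)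
    (hzK : ∀ x ∈ Ω, ∀ s ∈ Set.Icc a b, z x s ∈ K)
    (Φ : Phase d → Phase d) (hΦ : ∀ x ∈ Ω, Φ x = z x b)
    (ε : ℝ) (hε : 0 < ε) :
    ∃ (Vq Vp : ℝ → Vec d → ℝ) (ψ : ℝ → Phase d → Phase d),
      ShallowClass σ Vq ∧ ShallowClass σ Vp ∧
      (∀ x ∈ Ω, ψ 0 x = x) ∧
      (∀ x ∈ Ω, ∀ s ∈ Set.Icc (0:ℝ) 1,
        HasDerivWithinAt (fun u => ψ u x)
          (JgradH (fun y : Phase d => Vp s y.2 + Vq s y.1) (ψ s x)) (Set.Icc 0 1) s) ∧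
      (∀ x ∈ Ω, supNorm (ψ 1 x - Φ x) < ε) := by
  obtain ⟨g, hg, hgΦ⟩ := (hHt.steppable a b).exists_reachable_near hab hK hza hz hzK
    (ε := ε / 3) (by positivity)
  obtain ⟨Vq, Vp, ψ, hq, hp, h0, hψ, hψg⟩ := hg.exists_shallow_flow_near hσ hσp hΩ
    (ε := ε / 3) (by positivity)
  refine ⟨Vq, Vp, ψ, hq, hp, h0, hψ, fun x hx => (supNorm_le_norm _).trans_lt ?_⟩
  have h1 := hψg x hx
  have h2 := hgΦ x hx
  rw [hΦ x hx]
  linarith [norm_sub_le_norm_sub_add_norm_sub (ψ 1 x) (g x) (z x b)]
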